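/- arXiv:1906.00661 — 5 statements merged into one kernel-verified Lean document; each statement's English description precedes it below -/
import Mathlib

section
/- For all real parameters a > 0, b > 0 with a + b > 1 and every real z > 1, the Cauchy transform of the free beta distribution satisfies G_{υ_{a,b}}(z) = ((a+b−2)z + (1−a) − √((a+b)²z² − 2(ab+a²−a+b)z + (a−1)²)) / (2z(1−z)), where the square root is the nonnegative real square root (the radicand is nonnegative for z ≥ 1, since its two roots κ₋, κ₊ lie in [0,1]). -/
open MeasureTheory Real

/-- `κ₋` for the free beta distribution. -/
noncomputable def kappaM (a b : ℝ) : ℝ :=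
  ((Real.sqrt (a * (a + b - 1)) - Real.sqrt b) / (a + b)) ^ 2

/-- `κ₊` for the free beta distribution. -/
noncomputable def kappaP (a b : ℝ) : ℝ :=
  ((Real.sqrt (a * (a + b - 1)) + Real.sqrt b) / (a + b)) ^ 2

/-- Density of the absolutely continuous part of the free beta distribution. -/
noncomputable def fbDensity (a b : ℝ) : ℝ → ℝ :=
  Set.indicator (Set.Icc (kappaM a b) (kappaP a b))
    (fun x => (a + b) * Real.sqrt (-((x - kappaP a b) * (x - kappaM a b)))
      / (2 * π * x * (1 - x)))

/-- The free beta distribution `fβ(a, b)`. -/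
noncomputable def fbeta (a b : ℝ) : Measure ℝ :=
  volume.withDensity (fun x => ENNReal.ofReal (fbDensity a b x))
    + ENNReal.ofReal (max (1 - a) 0) • Measure.dirac 0
    + ENNReal.ofReal (max (1 - b) 0) • Measure.dirac 1


lemma J_center (r W : ℝ) (hr : 0 < r) (hW : r ≤ W) :
    IntervalIntegrable (fun u => √(r ^ 2 - u ^ 2) / (W - u)) volume (-r) r ∧
      ∫ u in (-r)..r, √(r ^ 2 - u ^ 2) / (W - u) = π * (W - √(W ^ 2 - r ^ 2)) := by
  set F : ℝ → ℝ := fun u => -√(r ^ 2 - u ^ 2) + W * arcsin (u / r)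
    - √(W ^ 2 - r ^ 2) * arcsin ((W * u - r ^ 2) / (r * (W - u))) with hF
  have hle : -r ≤ r := by linarith
  have hcont : ContinuousOn F (Set.Icc (-r) r) := by
    have h1 : ContinuousOn (fun u => -√(r ^ 2 - u ^ 2) + W * arcsin (u / r))
        (Set.Icc (-r) r) := by
      apply Continuous.continuousOn
      have := continuous_arcsin
      fun_prop
    rcases eq_or_lt_of_le hW with h | h
    · subst h
      simpa [hF] using h1
    · apply h1.sub
      apply ContinuousOn.mul continuousOn_const
      apply continuous_arcsin.comp_continuousOn
      apply ContinuousOn.div (by fun_prop) (by fun_prop)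
      intro x hx
      have : 0 < W - x := by linarith [hx.2]
      positivity
  have hderiv : ∀ u ∈ Set.Ioo (-r) r, HasDerivAt F (√(r ^ 2 - u ^ 2) / (W - u)) u := by
    intro u hu
    have hWu : 0 < W - u := by linarith [hu.2]
    have hs : 0 < r ^ 2 - u ^ 2 := by nlinarith [hu.1, hu.2]
    have hsp : 0 < √(r ^ 2 - u ^ 2) := sqrt_pos.2 hs
    have hsq : √(r ^ 2 - u ^ 2) ^ 2 = r ^ 2 - u ^ 2 := sq_sqrt hs.le
    have d1 : HasDerivAt (fun u => √(r ^ 2 - u ^ 2)) (-u / √(r ^ 2 - u ^ 2)) u := by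
      have h0 : HasDerivAt (fun u : ℝ => r ^ 2 - u ^ 2) (-(2 * u)) u := by
        simpa using (hasDerivAt_pow 2 u).const_sub (r ^ 2)
      refine (h0.sqrt hs.ne').congr_deriv ?_
      field_simp
    have d2 : HasDerivAt (fun u => arcsin (u / r)) (1 / √(r ^ 2 - u ^ 2)) u := by
      have h1 : u / r ≠ -1 := by
        intro h; rw [div_eq_iff hr.ne'] at h; linarith [hu.1]
      have h2 : u / r ≠ 1 := by
        intro h; rw [div_eq_iff hr.ne'] at h; linarith [hu.2]
      have := (hasDerivAt_arcsin h1 h2).comp u ((hasDerivAt_id u).div_const r)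
      refine this.congr_deriv ?_
      have : √(1 - (u / r) ^ 2) = √(r ^ 2 - u ^ 2) / r := by
        rw [show 1 - (u / r) ^ 2 = (r ^ 2 - u ^ 2) / r ^ 2 by field_simp,
          sqrt_div hs.le, sqrt_sq hr.le]
      rw [this]
      field_simp
    have d3 : HasDerivAt (fun u => √(W ^ 2 - r ^ 2) * arcsin ((W * u - r ^ 2) / (r * (W - u))))
        ((W ^ 2 - r ^ 2) / ((W - u) * √(r ^ 2 - u ^ 2))) u := by
      rcases eq_or_lt_of_le hW with h | h
      · subst h
        simpa using hasDerivAt_const u (0 : ℝ)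
      · have hD : 0 < W ^ 2 - r ^ 2 := by nlinarith
        have hDp : 0 < √(W ^ 2 - r ^ 2) := sqrt_pos.2 hD
        have hDq : √(W ^ 2 - r ^ 2) ^ 2 = W ^ 2 - r ^ 2 := sq_sqrt hD.le
        have hden : r * (W - u) ≠ 0 := by positivity
        have h1 : (W * u - r ^ 2) / (r * (W - u)) ≠ -1 := by
          intro h; rw [div_eq_iff hden] at h; nlinarith [hu.1]
        have h2 : (W * u - r ^ 2) / (r * (W - u)) ≠ 1 := by
          intro h; rw [div_eq_iff hden] at h; nlinarith [hu.2]
        have e1 : HasDerivAt (fun u => (W * u - r ^ 2) / (r * (W - u)))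
            ((W ^ 2 - r ^ 2) / (r * (W - u) ^ 2)) u := by
          have := (((hasDerivAt_id u).const_mul W).sub_const (r ^ 2)).div
            (((hasDerivAt_id u).const_sub W).const_mul r) hden
          refine this.congr_deriv ?_
          simp
          field_simp
          ring
        have := ((hasDerivAt_arcsin h1 h2).comp u e1).const_mul (√(W ^ 2 - r ^ 2))
        refine this.congr_deriv ?_
        have : √(1 - ((W * u - r ^ 2) / (r * (W - u))) ^ 2)
            = √(W ^ 2 - r ^ 2) * √(r ^ 2 - u ^ 2) / (r * (W - u)) := by
          rw [show 1 - ((W * u - r ^ 2) / (r * (W - u))) ^ 2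
              = ((W ^ 2 - r ^ 2) * (r ^ 2 - u ^ 2)) / (r * (W - u)) ^ 2 by field_simp; ring,
            sqrt_div (by positivity), sqrt_sq (by positivity), sqrt_mul hD.le]
        rw [this]
        field_simp
    refine ((d1.neg.add (d2.const_mul W)).sub d3).congr_deriv ?_
    field_simp
    rw [hsq]
    ring
  have hint : IntervalIntegrable (fun u => √(r ^ 2 - u ^ 2) / (W - u)) volume (-r) r := by
    rw [intervalIntegrable_iff_integrableOn_Ioc_of_le hle]
    refine intervalIntegral.integrableOn_deriv_of_nonneg hcont hderiv ?_
    intro x hx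
    have : 0 < W - x := by linarith [hx.2]
    positivity
  refine ⟨hint, ?_⟩
  rw [intervalIntegral.integral_eq_sub_of_hasDerivAt_of_le hle hcont hderiv hint]
  have hrr : r / r = 1 := div_self hr.ne'
  have hrr' : -r / r = -1 := by rw [neg_div, hrr]
  have h4 : (W * -r - r ^ 2) / (r * (W - -r)) = -1 := by
    have : 0 < W + r := by linarith
    rw [div_eq_iff (by rw [sub_neg_eq_add]; positivity)]; ring
  rcases eq_or_lt_of_le hW with h | h
  · subst h
    simp [hF, hrr, hrr']
    ring
  · have h3 : (W * r - r ^ 2) / (r * (W - r)) = 1 := by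
      have : 0 < W - r := by linarith
      rw [div_eq_iff (by positivity)]; ring
    simp only [hF, hrr, hrr', h3, h4, arcsin_one, arcsin_neg_one]
    simp
    ring

lemma J_right (m p w : ℝ) (hmp : m < p) (hw : p ≤ w) :
    IntegrableOn (fun x => √(-((x - p) * (x - m))) / (w - x)) (Set.Ioo m p) ∧
      ∫ x in Set.Ioo m p, √(-((x - p) * (x - m))) / (w - x)
        = π * (w - (p + m) / 2 - √((w - p) * (w - m))) := by
  obtain ⟨h1, h2⟩ := J_center ((p - m) / 2) (w - (p + m) / 2) (by linarith) (by linarith)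
  have hf : (fun x => √(-((x - p) * (x - m))) / (w - x)) = fun x =>
      (fun u => √(((p - m) / 2) ^ 2 - u ^ 2) / ((w - (p + m) / 2) - u)) (x - (p + m) / 2) := by
    funext x
    simp only
    congr 1
    · congr 1; ring
    · ring
  have h3 := h1.comp_sub_right ((p + m) / 2)
  rw [← hf] at h3
  rw [show -((p - m) / 2) + (p + m) / 2 = m by ring,
    show (p - m) / 2 + (p + m) / 2 = p by ring] at h3
  rw [intervalIntegrable_iff_integrableOn_Ioo_of_le hmp.le] at h3
  refine ⟨h3, ?_⟩
  rw [← integral_Ioc_eq_integral_Ioo, ← intervalIntegral.integral_of_le hmp.le, hf,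
    intervalIntegral.integral_comp_sub_right (fun u => √(((p - m) / 2) ^ 2 - u ^ 2) / ((w - (p + m) / 2) - u)),
    show m - (p + m) / 2 = -((p - m) / 2) by ring, show p - (p + m) / 2 = (p - m) / 2 by ring, h2]
  congr 3
  ring

lemma J_left (m p w : ℝ) (hmp : m < p) (hw : w ≤ m) :
    IntegrableOn (fun x => √(-((x - p) * (x - m))) / (x - w)) (Set.Ioo m p) ∧
      ∫ x in Set.Ioo m p, √(-((x - p) * (x - m))) / (x - w)
        = π * ((p + m) / 2 - w - √((p - w) * (m - w))) := by
  obtain ⟨h1, h2⟩ := J_center ((p - m) / 2) ((p + m) / 2 - w) (by linarith) (by linarith)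
  have hf : (fun x => √(-((x - p) * (x - m))) / (x - w)) = fun x =>
      (fun u => √(((p - m) / 2) ^ 2 - u ^ 2) / (((p + m) / 2 - w) - u)) ((p + m) / 2 - x) := by
    funext x
    simp only
    congr 1
    · congr 1; ring
    · ring
  have h3 := (h1.comp_sub_left ((p + m) / 2)).symm
  rw [← hf] at h3
  rw [show (p + m) / 2 - -((p - m) / 2) = p by ring,
    show (p + m) / 2 - (p - m) / 2 = m by ring] at h3
  rw [intervalIntegrable_iff_integrableOn_Ioo_of_le hmp.le] at h3
  refine ⟨h3, ?_⟩
  rw [← integral_Ioc_eq_integral_Ioo, ← intervalIntegral.integral_of_le hmp.le, hf,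
    intervalIntegral.integral_comp_sub_left (fun u => √(((p - m) / 2) ^ 2 - u ^ 2) / (((p + m) / 2 - w) - u)),
    show (p + m) / 2 - p = -((p - m) / 2) by ring, show (p + m) / 2 - m = (p - m) / 2 by ring, h2]
  congr 3
  ring

lemma kappa_facts (a b : ℝ) (ha : 0 < a) (hb : 0 < b) (hab : 1 < a + b) :
    0 ≤ kappaM a b ∧ kappaM a b < kappaP a b ∧ kappaP a b ≤ 1 ∧
    (a + b) ^ 2 * (kappaP a b + kappaM a b) = 2 * (a * b + a ^ 2 - a + b) ∧
    (a + b) ^ 2 * (kappaP a b * kappaM a b) = (a - 1) ^ 2 := by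
  unfold kappaM kappaP
  have hA : 0 < a * (a + b - 1) := mul_pos ha (by linarith)
  have hS := sqrt_pos.2 hA
  have hT := sqrt_pos.2 hb
  have hS2 := sq_sqrt hA.le
  have hT2 := sq_sqrt hb.le
  set S := √(a * (a + b - 1))
  set T := √b
  have hc : 0 < a + b := by linarith
  refine ⟨by positivity, ?_, ?_, ?_, ?_⟩
  · rw [div_pow, div_pow]
    gcongr ?_ / _
    nlinarith [mul_pos hS hT]
  · have hST : S + T ≤ a + b := by
      have : (S * T) ≤ (a + b * (a + b - 1)) / 2 := by
        have h : (S * T) ^ 2 = (a * b) * (a + b - 1) := by rw [mul_pow, hS2, hT2]; ring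
        apply le_of_sq_le_sq
        · rw [h]; nlinarith [sq_nonneg (a - b * (a + b - 1))]
        · have := mul_pos hb (by linarith : 0 < a + b - 1); linarith
      apply le_of_sq_le_sq
      · nlinarith
      · exact hc.le
    rw [sq_le_one_iff₀ (by positivity), div_le_one hc]
    exact hST
  · field_simp
    nlinarith
  · have : (S + T) * (S - T) = (a + b) * (a - 1) := by nlinarith
    rw [← mul_pow, div_mul_div_comm, this]
    field_simp

theorem cauchy_transform_fbeta (a b z : ℝ) (ha : 0 < a) (hb : 0 < b)
    (hab : 1 < a + b) (hz : 1 < z) :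
    ∫ x, 1 / (z - x) ∂(fbeta a b)
      = ((a + b - 2) * z + (1 - a)
          - Real.sqrt ((a + b) ^ 2 * z ^ 2 - 2 * (a * b + a ^ 2 - a + b) * z + (a - 1) ^ 2))
        / (2 * z * (1 - z)) := by
  obtain ⟨hm, hmp, hp, hsum, hprod⟩ := kappa_facts a b ha hb hab
  have hc : 0 < a + b := by linarith
  have hmeas : Measurable (fbDensity a b) := by
    unfold fbDensity
    apply Measurable.indicator _ measurableSet_Icc
    fun_prop
  have hnn : ∀ x, 0 ≤ fbDensity a b x := by
    intro x
    unfold fbDensity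
    apply Set.indicator_nonneg
    intro x hx
    have h0 : 0 ≤ x := hm.trans hx.1
    have h1 : 0 ≤ 1 - x := by linarith [hx.2]
    have := pi_pos
    positivity
  unfold fbeta
  set m := kappaM a b
  set p := kappaP a b
  obtain ⟨i0, j0⟩ := J_left m p 0 hmp hm
  obtain ⟨i1, j1⟩ := J_right m p 1 hmp hp
  obtain ⟨iz, jz⟩ := J_right m p z hmp (by linarith)
  -- the density on the open interval
  have hind : (fun x => fbDensity a b x * (1 / (z - x))) =ᵐ[volume]
      Set.indicator (Set.Ioo m p) (fun x => (a + b) / (2 * π) *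
        ((1 / z) * (√(-((x - p) * (x - m))) / (x - 0))
          + (1 / (z - 1)) * (√(-((x - p) * (x - m))) / (1 - x))
          + (1 / (z * (1 - z))) * (√(-((x - p) * (x - m))) / (z - x)))) := by
    have hmz : ∀ᵐ x ∂(volume : Measure ℝ), x ≠ m := by simp [ae_iff]
    have hpz : ∀ᵐ x ∂(volume : Measure ℝ), x ≠ p := by simp [ae_iff]
    filter_upwards [hmz, hpz] with x hxm hxp
    by_cases hx : x ∈ Set.Ioo m p
    · have hx' : x ∈ Set.Icc m p := Set.Ioo_subset_Icc_self hx
      rw [Set.indicator_of_mem hx]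
      unfold fbDensity
      rw [Set.indicator_of_mem hx']
      have h0 : x ≠ 0 := by have := hx.1; intro h; linarith
      have h1 : 1 - x ≠ 0 := by have := hx.2; intro h; linarith
      have h2 : z - x ≠ 0 := by have := hx.2; intro h; linarith
      have h3 : z ≠ 0 := by linarith
      have h4 : z - 1 ≠ 0 := by linarith
      have h5 : 1 - z ≠ 0 := by intro h; linarith
      have h6 : (1 - z) = -(z - 1) := by ring
      rw [h6, sub_zero]
      have := pi_pos.ne'
      field_simp
      ring
    · have hx' : x ∉ Set.Icc m p := by
        intro h
        exact hx ⟨lt_of_le_of_ne h.1 (Ne.symm hxm), lt_of_le_of_ne h.2 hxp⟩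
      rw [Set.indicator_of_notMem hx]
      unfold fbDensity
      rw [Set.indicator_of_notMem hx', zero_mul]
  have k0 := i0.const_mul (1 / z)
  have k1 := i1.const_mul (1 / (z - 1))
  have kz := iz.const_mul (1 / (z * (1 - z)))
  have hI : Integrable (fun x => fbDensity a b x * (1 / (z - x))) volume := by
    refine Integrable.congr ?_ hind.symm
    rw [integrable_indicator_iff measurableSet_Ioo]
    exact ((k0.add k1).add kz).const_mul _
  have hV : ∫ x, fbDensity a b x * (1 / (z - x)) = (a + b) / (2 * π) *
      ((1 / z) * (π * ((p + m) / 2 - 0 - √((p - 0) * (m - 0))))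
        + (1 / (z - 1)) * (π * (1 - (p + m) / 2 - √((1 - p) * (1 - m))))
        + (1 / (z * (1 - z))) * (π * (z - (p + m) / 2 - √((z - p) * (z - m))))) := by
    rw [integral_congr_ae hind, integral_indicator measurableSet_Ioo, integral_const_mul,
      integral_add (by exact k0.add k1) kz, integral_add k0 k1, integral_const_mul, integral_const_mul,
      integral_const_mul, j0, j1, jz]
  have hfin : ∀ᵐ x ∂(volume : Measure ℝ), ENNReal.ofReal (fbDensity a b x) < ⊤ := by simp
  have hI1 : Integrable (fun x => 1 / (z - x))
      (volume.withDensity (fun x => ENNReal.ofReal (fbDensity a b x))) := by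
    rw [integrable_withDensity_iff_integrable_smul' hmeas.ennreal_ofReal hfin]
    simpa only [ENNReal.toReal_ofReal (hnn _), smul_eq_mul] using hI
  have hI2 : ∀ c y : ℝ, Integrable (fun x => 1 / (z - x))
      (ENNReal.ofReal c • Measure.dirac y) := by
    intro c y
    exact (integrable_dirac (by simp)).smul_measure ENNReal.ofReal_ne_top
  rw [integral_add_measure (hI1.add_measure (hI2 _ _)) (hI2 _ _),
    integral_add_measure hI1 (hI2 _ _), integral_smul_measure, integral_smul_measure,
    integral_dirac, integral_dirac,
    integral_withDensity_eq_integral_toReal_smul hmeas.ennreal_ofReal hfin]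
  simp only [ENNReal.toReal_ofReal (hnn _), smul_eq_mul]
  rw [hV, ENNReal.toReal_ofReal (le_max_right _ _), ENNReal.toReal_ofReal (le_max_right _ _)]
  -- square roots
  have s0 : (a + b) * √((p - 0) * (m - 0)) = |1 - a| := by
    rw [← sqrt_sq hc.le, ← sqrt_mul (by positivity), sub_zero, sub_zero, hprod, sqrt_sq_eq_abs,
      abs_sub_comm]
  have s1 : (a + b) * √((1 - p) * (1 - m)) = |1 - b| := by
    rw [← sqrt_sq hc.le, ← sqrt_mul (by positivity), ← sqrt_sq_eq_abs]
    congr 1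
    linear_combination -hsum + hprod
  have sz : (a + b) * √((z - p) * (z - m)) =
      √((a + b) ^ 2 * z ^ 2 - 2 * (a * b + a ^ 2 - a + b) * z + (a - 1) ^ 2) := by
    rw [← sqrt_sq hc.le, ← sqrt_mul (by positivity), sqrt_sq hc.le]
    congr 1
    linear_combination -z * hsum + hprod
  have m0 : max (1 - a) 0 = (1 - a + |1 - a|) / 2 := by
    rcases le_total 0 (1 - a) with h | h
    · rw [max_eq_left h, abs_of_nonneg h]; ring
    · rw [max_eq_right h, abs_of_nonpos h]; ring
  have m1 : max (1 - b) 0 = (1 - b + |1 - b|) / 2 := by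
    rcases le_total 0 (1 - b) with h | h
    · rw [max_eq_left h, abs_of_nonneg h]; ring
    · rw [max_eq_right h, abs_of_nonpos h]; ring
  rw [m0, m1, ← s0, ← s1, ← sz]
  have h3 : z ≠ 0 := by linarith
  have h4 : z - 1 ≠ 0 := by intro h; linarith
  have h6 : (1 - z) = -(z - 1) := by ring
  rw [h6, sub_zero z]
  have := pi_pos.ne'
  field_simp
  ring
end

section
/- For all real parameters a > 0, b > 1 and every x in the open interval (γ₋, γ₊), the free score function of the free beta prime distribution equals the derivative of the classical beta prime potential: lim_{ε→0⁺} 2·Re G_{μ_{a,b}}(x + iε) = ((b+1)x + (1−a)) / (x(1+x)). -/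
open MeasureTheory Real Filter

/-- `γ₋` for the free beta prime distribution. -/
noncomputable def gammaM (a b : ℝ) : ℝ :=
  ((Real.sqrt (a * b) - Real.sqrt (a + b - 1)) / (b - 1)) ^ 2

/-- `γ₊` for the free beta prime distribution. -/
noncomputable def gammaP (a b : ℝ) : ℝ :=
  ((Real.sqrt (a * b) + Real.sqrt (a + b - 1)) / (b - 1)) ^ 2

/-- Density of the absolutely continuous part of the free beta prime distribution. -/
noncomputable def fbpDensity (a b : ℝ) : ℝ → ℝ :=
  Set.indicator (Set.Icc (gammaM a b) (gammaP a b))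
    (fun x => (b - 1) * Real.sqrt (-((x - gammaP a b) * (x - gammaM a b)))
      / (2 * π * x * (1 + x)))

/-- The free beta prime distribution `fβ'(a, b)`. -/
noncomputable def fbp (a b : ℝ) : Measure ℝ :=
  volume.withDensity (fun x => ENNReal.ofReal (fbpDensity a b x))
    + ENNReal.ofReal (max (1 - a) 0) • Measure.dirac 0


lemma den_ne (u : ℂ) (hu : ‖u‖ < 1) (z : ℂ) (hz : ‖z‖ = 1) : 1 - u * z ≠ 0 := by
  intro h
  have h1 : u * z = 1 := (sub_eq_zero.mp h).symm
  have h2 : ‖u * z‖ = 1 := by rw [h1]; simp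
  rw [norm_mul, hz, mul_one] at h2
  linarith

lemma D_eq (u : ℂ) (θ : ℝ) : 1 - 2 * u * (Real.cos θ : ℂ) + u ^ 2
    = (1 - u * Complex.exp (θ * Complex.I)) * (1 - u * Complex.exp (-(θ * Complex.I))) := by
  have h : Complex.exp (θ * Complex.I) * Complex.exp (-(θ * Complex.I)) = 1 := by
    rw [← Complex.exp_add]; simp
  rw [Complex.ofReal_cos, Complex.cos]
  rw [neg_mul]
  linear_combination (-u^2) * h

lemma D_ne (u : ℂ) (hu : ‖u‖ < 1) (θ : ℝ) : 1 - 2 * u * (Real.cos θ : ℂ) + u ^ 2 ≠ 0 := by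
  rw [D_eq]
  refine mul_ne_zero (den_ne u hu _ (Complex.norm_exp_ofReal_mul_I θ)) (den_ne u hu _ ?_)
  have := Complex.norm_exp_ofReal_mul_I (-θ)
  simpa using this

lemma poisson_full (u : ℂ) (hu : ‖u‖ < 1) :
    ∫ θ in (0:ℝ)..(2 * π), (1 - 2 * u * (Real.cos θ : ℂ) + u ^ 2)⁻¹ = 2 * π / (1 - u ^ 2) := by
  have hd : DifferentiableOn ℂ (fun z : ℂ => (1 - u * z)⁻¹) (Metric.closedBall 0 1) := by
    intro z hz
    refine DifferentiableAt.differentiableWithinAt ?_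
    refine DifferentiableAt.inv (by fun_prop) ?_
    intro h
    have h1 : u * z = 1 := (sub_eq_zero.mp h).symm
    have h2 : ‖u * z‖ = 1 := by rw [h1]; simp
    rw [norm_mul] at h2
    have h3 : ‖z‖ ≤ 1 := by simpa using hz
    nlinarith [norm_nonneg u, norm_nonneg z]
  have h := hd.circleIntegral_sub_inv_smul (w := u) (by simpa using hu)
  rw [circleIntegral] at h
  have h2 : ∀ θ : ℝ, deriv (circleMap 0 1) θ • (circleMap 0 1 θ - u)⁻¹ •
      (fun z : ℂ => (1 - u * z)⁻¹) (circleMap 0 1 θ)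
      = Complex.I * (1 - 2 * u * (Real.cos θ : ℂ) + u ^ 2)⁻¹ := by
    intro θ
    have e1 : Complex.exp (θ * Complex.I) * Complex.exp (-(θ * Complex.I)) = 1 := by
      rw [← Complex.exp_add]; simp
    have hD := D_ne u hu θ
    rw [D_eq] at hD ⊢
    have n1 := left_ne_zero_of_mul hD
    have n2 := right_ne_zero_of_mul hD
    simp only [deriv_circleMap, circleMap, smul_eq_mul, zero_add, Complex.ofReal_one, one_mul]
    have e2 : Complex.exp (θ * Complex.I) - u = Complex.exp (θ * Complex.I) * (1 - u * Complex.exp (-(θ * Complex.I))) := by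
      linear_combination (u) * e1
    have n3 := Complex.exp_ne_zero (θ * Complex.I)
    rw [e2]
    field_simp
  simp only [h2] at h
  rw [intervalIntegral.integral_const_mul] at h
  have h3 : 1 - u ^ 2 ≠ 0 := by
    intro h
    have h1 : u ^ 2 = 1 := (sub_eq_zero.mp h).symm
    have h2 : ‖u ^ 2‖ = 1 := by rw [h1]; simp
    rw [norm_pow] at h2
    nlinarith [norm_nonneg u]
  have h4 := mul_left_cancel₀ Complex.I_ne_zero (a := Complex.I) (b := ∫ θ in (0:ℝ)..(2 * π), (1 - 2 * u * (Real.cos θ : ℂ) + u ^ 2)⁻¹) (c := 2 * π / (1 - u ^ 2)) 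
  apply h4
  rw [h, smul_eq_mul]
  rw [show 1 - u * u = 1 - u^2 by ring]
  field_simp

lemma D_cont (u : ℂ) (hu : ‖u‖ < 1) :
    Continuous (fun θ : ℝ => (1 - 2 * u * (Real.cos θ : ℂ) + u ^ 2)⁻¹) := by
  refine Continuous.inv₀ (by fun_prop) (D_ne u hu)

lemma poisson_half (u : ℂ) (hu : ‖u‖ < 1) :
    ∫ θ in (0:ℝ)..π, (1 - 2 * u * (Real.cos θ : ℂ) + u ^ 2)⁻¹ = π / (1 - u ^ 2) := by
  have h := poisson_full u hu
  have hc := D_cont u hu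
  rw [← intervalIntegral.integral_add_adjacent_intervals (b := π)
    (hc.intervalIntegrable _ _) (hc.intervalIntegrable _ _)] at h
  have h2 := intervalIntegral.integral_comp_sub_left (a := 0) (b := π)
    (fun θ : ℝ => (1 - 2 * u * (Real.cos θ : ℂ) + u ^ 2)⁻¹) (2 * π)
  simp only [Real.cos_two_pi_sub, sub_zero] at h2
  rw [show 2 * π - π = π by ring] at h2
  rw [← h2] at h
  linear_combination h / 2

lemma sin_int (u : ℂ) (hu : ‖u‖ < 1 ∨ u = -1) (h0 : u ≠ 0) :
    IntegrableOn (fun θ : ℝ => 2 * u * (Real.sin θ : ℂ) ^ 2 / (1 - 2 * u * (Real.cos θ : ℂ) + u ^ 2))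
      (Set.Ioo 0 π) ∧
    ∫ θ in Set.Ioo 0 π, 2 * u * (Real.sin θ : ℂ) ^ 2 / (1 - 2 * u * (Real.cos θ : ℂ) + u ^ 2)
      = π * u := by
  have sc : ∀ θ : ℝ, (Real.sin θ : ℂ) ^ 2 = 1 - (Real.cos θ : ℂ) ^ 2 := by
    intro θ
    have := Real.sin_sq θ
    exact_mod_cast this
  have ic : ∫ θ in (0:ℝ)..π, (Real.cos θ : ℂ) = 0 := by
    rw [intervalIntegral.integral_ofReal]; simp
  rcases hu with hu | hu
  · have hc := D_cont u hu
    have e : ∀ θ : ℝ, 2 * u * (Real.sin θ : ℂ) ^ 2 / (1 - 2 * u * (Real.cos θ : ℂ) + u ^ 2)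
        = (Real.cos θ : ℂ) + ((1 + u ^ 2) / (2 * u)
          - (1 - u ^ 2) ^ 2 / (2 * u) * (1 - 2 * u * (Real.cos θ : ℂ) + u ^ 2)⁻¹) := by
      intro θ
      have := D_ne u hu θ
      rw [sc]
      field_simp
      ring
    simp only [e]
    have c1 : Continuous (fun θ : ℝ => (Real.cos θ : ℂ)) := by fun_prop
    have c2 : Continuous (fun θ : ℝ => (1 - u ^ 2) ^ 2 / (2 * u) * (1 - 2 * u * (Real.cos θ : ℂ) + u ^ 2)⁻¹) :=
      continuous_const.mul hc
    have c3 : Continuous (fun θ : ℝ => (1 + u ^ 2) / (2 * u)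
          - (1 - u ^ 2) ^ 2 / (2 * u) * (1 - 2 * u * (Real.cos θ : ℂ) + u ^ 2)⁻¹) :=
      continuous_const.sub c2
    constructor
    · exact ((c1.add c3).integrableOn_Icc).mono_set Set.Ioo_subset_Icc_self
    · rw [← integral_Ioc_eq_integral_Ioo, ← intervalIntegral.integral_of_le Real.pi_pos.le]
      rw [intervalIntegral.integral_add (c1.intervalIntegrable _ _) (c3.intervalIntegrable _ _),
        intervalIntegral.integral_sub (continuous_const.intervalIntegrable _ _) (c2.intervalIntegrable _ _),
        intervalIntegral.integral_const_mul, poisson_half u hu, ic]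
      have h3 : 1 - u ^ 2 ≠ 0 := by
        intro h
        have h1 : u ^ 2 = 1 := (sub_eq_zero.mp h).symm
        have h2 : ‖u ^ 2‖ = 1 := by rw [h1]; simp
        rw [norm_pow] at h2
        nlinarith [norm_nonneg u]
      simp only [intervalIntegral.integral_const, sub_zero, Complex.real_smul]
      field_simp
      ring
  · have e : Set.EqOn (fun θ : ℝ => 2 * u * (Real.sin θ : ℂ) ^ 2 / (1 - 2 * u * (Real.cos θ : ℂ) + u ^ 2))
      (fun θ : ℝ => (Real.cos θ : ℂ) - 1) (Set.Ioo 0 π) := by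
      intro θ hθ
      have h1 : 0 < Real.sin θ := Real.sin_pos_of_mem_Ioo hθ
      have h2 : 1 + Real.cos θ ≠ 0 := by
        intro h
        nlinarith [Real.sin_sq_add_cos_sq θ]
      have h3 : (1 + Real.cos θ : ℂ) ≠ 0 := by exact_mod_cast h2
      simp only [sc, hu]
      have h4 : (1 - 2 * (-1) * (Real.cos θ : ℂ) + (-1) ^ 2) = 2 * (1 + Real.cos θ) := by ring
      rw [h4]
      field_simp
      ring
    have c1 : Continuous (fun θ : ℝ => (Real.cos θ : ℂ)) := by fun_prop
    have c3 : Continuous (fun θ : ℝ => (Real.cos θ : ℂ) - 1) := by fun_prop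
    constructor
    · exact (integrableOn_congr_fun e measurableSet_Ioo).mpr
        ((c3.integrableOn_Icc).mono_set Set.Ioo_subset_Icc_self)
    · rw [setIntegral_congr_fun measurableSet_Ioo e]
      rw [← integral_Ioc_eq_integral_Ioo, ← intervalIntegral.integral_of_le Real.pi_pos.le]
      rw [intervalIntegral.integral_sub (c1.intervalIntegrable _ _) (continuous_const.intervalIntegrable _ _), ic, hu]
      simp

lemma K_int (m r : ℝ) (hr : 0 < r) (w u : ℂ) (hu : ‖u‖ < 1 ∨ u = -1)
    (h : 2 * u * (w - m) = r * (1 + u ^ 2)) :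
    IntegrableOn (fun θ : ℝ => (r : ℂ) ^ 2 * (Real.sin θ : ℂ) ^ 2 / (w - (m + r * (Real.cos θ : ℂ))))
      (Set.Ioo 0 π) ∧
    ∫ θ in Set.Ioo 0 π, (r : ℂ) ^ 2 * (Real.sin θ : ℂ) ^ 2 / (w - (m + r * (Real.cos θ : ℂ)))
      = π * (r * u) := by
  have hr' : (r : ℂ) ≠ 0 := by exact_mod_cast hr.ne'
  have h0 : u ≠ 0 := by
    rintro rfl
    simp at h
    exact hr' h.symm
  obtain ⟨h1, h2⟩ := sin_int u hu h0
  have e : ∀ θ : ℝ, (r : ℂ) ^ 2 * (Real.sin θ : ℂ) ^ 2 / (w - (m + r * (Real.cos θ : ℂ)))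
      = r * (2 * u * (Real.sin θ : ℂ) ^ 2 / (1 - 2 * u * (Real.cos θ : ℂ) + u ^ 2)) := by
    intro θ
    have : (1 - 2 * u * (Real.cos θ : ℂ) + u ^ 2) = (2 * u / r) * (w - (m + r * (Real.cos θ : ℂ))) := by
      field_simp
      linear_combination -h
    rw [this]
    by_cases hz : (w - (m + r * (Real.cos θ : ℂ))) = 0
    · rw [hz]; simp
    · field_simp
  simp only [e]
  refine ⟨h1.const_mul _, ?_⟩
  rw [integral_const_mul, h2]; ring

lemma exists_u_real (m r w : ℝ) (hr : 0 < r) (hw : w ≤ m - r) :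
    ∃ u : ℂ, (‖u‖ < 1 ∨ u = -1) ∧ 2 * u * ((w : ℂ) - m) = r * (1 + u ^ 2) ∧
      (r : ℂ) * u = ((w - m + Real.sqrt ((w - m) ^ 2 - r ^ 2) : ℝ) : ℂ) := by
  set s := Real.sqrt ((w - m) ^ 2 - r ^ 2) with hs
  have hs2 : s ^ 2 = (w - m) ^ 2 - r ^ 2 := Real.sq_sqrt (by nlinarith)
  have hs0 : 0 ≤ s := Real.sqrt_nonneg _
  refine ⟨(((w - m + s) / r : ℝ) : ℂ), ?_, ?_, ?_⟩
  · have hlt : w - m + s < 0 := by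
      by_contra hh
      nlinarith
    rcases hw.lt_or_eq with hw | hw
    · left
      rw [Complex.norm_real, Real.norm_eq_abs, abs_lt]
      constructor
      · rw [lt_div_iff₀ hr]
        by_contra hh
        nlinarith
      · rw [div_lt_iff₀ hr]; linarith
    · right
      have : s = 0 := by
        have : s ^ 2 = 0 := by rw [hs2, hw]; ring
        exact pow_eq_zero_iff (two_ne_zero) |>.mp this
      rw [this, hw]
      have : (m - r - m + 0) / r = -1 := by field_simp; ring
      rw [this]; simp
  · have : 2 * ((w - m + s) / r) * (w - m) = r * (1 + ((w - m + s) / r) ^ 2) := by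
      field_simp
      linear_combination -hs2
    exact_mod_cast this
  · have : r * ((w - m + s) / r) = w - m + s := by field_simp
    exact_mod_cast this

lemma exists_u_im (c : ℂ) (hc : c.im ≠ 0) : ∃ u : ℂ, ‖u‖ < 1 ∧ u ^ 2 + 1 = 2 * c * u := by
  obtain ⟨d, hd⟩ := IsAlgClosed.exists_eq_mul_self (c ^ 2 - 1)
  have hp : (c + d) * (c - d) = 1 := by linear_combination hd
  have hn : ‖c + d‖ * ‖c - d‖ = 1 := by rw [← norm_mul, hp]; simp
  rcases lt_trichotomy (‖c + d‖) 1 with h | h | h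
  · exact ⟨c + d, h, by linear_combination -hd⟩
  · exfalso
    have h1 : (c + d)⁻¹ = c - d := inv_eq_of_mul_eq_one_right hp
    rw [Complex.inv_eq_conj h] at h1
    have := congrArg Complex.im h1
    simp at this
    apply hc; linarith
  · exact ⟨c - d, by
      by_contra hh
      nlinarith [norm_nonneg (c - d)], by linear_combination -hd⟩

lemma re_bound (x0 η : ℝ) (hx : x0 ^ 2 < 1) (u : ℂ)
    (hu : u ^ 2 + 1 = 2 * (x0 + η * Complex.I) * u) :
    (u.re - x0) ^ 2 ≤ x0 ^ 2 * η ^ 2 / (1 - x0 ^ 2) := by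
  have h1 := congrArg Complex.re hu
  have h2 := congrArg Complex.im hu
  simp [pow_two] at h1 h2
  rw [le_div_iff₀ (by linarith)]
  set P := u.re - x0 with hP
  set Q := u.im - η with hQ
  have e1 : P ^ 2 - Q ^ 2 = x0 ^ 2 - η ^ 2 - 1 := by rw [hP, hQ]; linear_combination h1
  have e2 : P * Q = x0 * η := by rw [hP, hQ]; linear_combination h2 / 2
  have e3 : P ^ 2 * Q ^ 2 = x0 ^ 2 * η ^ 2 := by rw [← mul_pow, e2]; ring
  nlinarith [mul_nonneg (sq_nonneg P) (sq_nonneg η), mul_nonneg (sq_nonneg P) (sq_nonneg P)]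

lemma image_cos (m r : ℝ) (hr : 0 < r) :
    (fun θ : ℝ => m + r * Real.cos θ) '' Set.Ioo 0 π = Set.Ioo (m - r) (m + r) := by
  ext t
  constructor
  · rintro ⟨θ, hθ, rfl⟩
    have h1 : 0 < Real.sin θ := Real.sin_pos_of_mem_Ioo hθ
    have h2 := Real.sin_sq_add_cos_sq θ
    have h3 : Real.cos θ < 1 := by nlinarith
    have h4 : -1 < Real.cos θ := by nlinarith
    constructor
    · show m - r < m + r * Real.cos θ
      nlinarith
    · show m + r * Real.cos θ < m + r
      nlinarith
  · rintro ⟨h1, h2⟩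
    have e1 : -1 < (t - m) / r := by rw [lt_div_iff₀ hr]; linarith
    have e2 : (t - m) / r < 1 := by rw [div_lt_iff₀ hr]; linarith
    refine ⟨Real.arccos ((t - m) / r), ⟨?_, ?_⟩, ?_⟩
    · exact Real.arccos_pos.mpr e2
    · exact lt_of_le_of_ne (Real.arccos_le_pi _) (fun h => by
        rw [Real.arccos_eq_pi] at h; linarith)
    · show m + r * Real.cos _ = t
      rw [Real.cos_arccos e1.le e2.le]
      field_simp
      ring

/-- The integral against the absolutely continuous part, in closed form. -/
lemma ac_int (m r b : ℝ) (hr : 0 < r) (hmr : 0 ≤ m - r) (z : ℂ) (hz : z.im ≠ 0) (u0 u1 uz : ℂ)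
    (h0 : ‖u0‖ < 1 ∨ u0 = -1) (h0' : 2 * u0 * (((0 : ℝ) : ℂ) - m) = r * (1 + u0 ^ 2))
    (h1 : ‖u1‖ < 1 ∨ u1 = -1) (h1' : 2 * u1 * (((-1 : ℝ) : ℂ) - m) = r * (1 + u1 ^ 2))
    (h2 : ‖uz‖ < 1 ∨ uz = -1) (h2' : 2 * uz * (z - m) = r * (1 + uz ^ 2)) :
    IntegrableOn (fun t : ℝ => ((b - 1) * Real.sqrt (-((t - (m + r)) * (t - (m - r))))
      / (2 * π * t * (1 + t))) • (z - (t : ℂ))⁻¹) (Set.Icc (m - r) (m + r)) ∧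
    ∫ t in Set.Icc (m - r) (m + r), ((b - 1) * Real.sqrt (-((t - (m + r)) * (t - (m - r))))
      / (2 * π * t * (1 + t))) • (z - (t : ℂ))⁻¹
      = ((b - 1) / 2 : ℝ) * (-(r * u0) * z⁻¹ + (r * u1) * (1 + z)⁻¹ + (r * uz) * (z * (1 + z))⁻¹) := by
  obtain ⟨i0, v0⟩ := K_int m r hr _ u0 h0 h0'
  obtain ⟨i1, v1⟩ := K_int m r hr _ u1 h1 h1'
  obtain ⟨i2, v2⟩ := K_int m r hr _ uz h2 h2'
  have hz0 : z ≠ 0 := by rintro rfl; simp at hz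
  have hz1 : 1 + z ≠ 0 := by
    intro h; apply hz
    have := congrArg Complex.im h
    simpa using this
  have hder : ∀ θ ∈ Set.Ioo 0 π, HasDerivWithinAt (fun θ : ℝ => m + r * Real.cos θ)
      (r * (-Real.sin θ)) (Set.Ioo 0 π) θ := fun θ _ =>
    (((Real.hasDerivAt_cos θ).const_mul r).const_add m).hasDerivWithinAt
  have hinj : Set.InjOn (fun θ : ℝ => m + r * Real.cos θ) (Set.Ioo 0 π) := by
    intro x hx y hy hxy
    have : Real.cos x = Real.cos y := by
      have h : m + r * Real.cos x = m + r * Real.cos y := hxy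
      exact mul_left_cancel₀ hr.ne' (add_left_cancel h)
    exact Real.injOn_cos (Set.Ioo_subset_Icc_self hx) (Set.Ioo_subset_Icc_self hy) this
  have e : Set.EqOn (fun θ : ℝ => |r * (-Real.sin θ)| •
      (fun t : ℝ => ((b - 1) * Real.sqrt (-((t - (m + r)) * (t - (m - r))))
      / (2 * π * t * (1 + t))) • (z - (t : ℂ))⁻¹) ((fun θ : ℝ => m + r * Real.cos θ) θ))
      (fun θ : ℝ => ((b - 1) / (2 * π) : ℝ) * (
        -z⁻¹ * ((r : ℂ) ^ 2 * (Real.sin θ : ℂ) ^ 2 / (((0 : ℝ) : ℂ) - (m + r * (Real.cos θ : ℂ))))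
        + (1 + z)⁻¹ * ((r : ℂ) ^ 2 * (Real.sin θ : ℂ) ^ 2 / (((-1 : ℝ) : ℂ) - (m + r * (Real.cos θ : ℂ))))
        + (z * (1 + z))⁻¹ * ((r : ℂ) ^ 2 * (Real.sin θ : ℂ) ^ 2 / (z - (m + r * (Real.cos θ : ℂ))))))
      (Set.Ioo 0 π) := by
    intro θ hθ
    have hs : 0 < Real.sin θ := Real.sin_pos_of_mem_Ioo hθ
    have hT : m + r * Real.cos θ ∈ Set.Ioo (m - r) (m + r) := by
      rw [← image_cos m r hr]; exact ⟨θ, hθ, rfl⟩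
    have hsq : Real.sqrt (-((m + r * Real.cos θ - (m + r)) * (m + r * Real.cos θ - (m - r))))
        = r * Real.sin θ := by
      rw [show -((m + r * Real.cos θ - (m + r)) * (m + r * Real.cos θ - (m - r)))
        = (r * Real.sin θ) ^ 2 by rw [mul_pow, Real.sin_sq]; ring]
      exact Real.sqrt_sq (by positivity)
    have habs : |r * (-Real.sin θ)| = r * Real.sin θ := by
      rw [mul_neg, abs_neg, abs_of_pos (by positivity)]
    simp only [hsq, habs]
    rw [show (m : ℂ) + r * (Real.cos θ : ℂ) = ((m + r * Real.cos θ : ℝ) : ℂ) by push_cast; ring]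
    have hTpos : 0 < m + r * Real.cos θ := lt_of_le_of_lt hmr hT.1
    generalize m + r * Real.cos θ = T at hTpos
    generalize Real.sin θ = s
    have n1 : (T : ℂ) ≠ 0 := by exact_mod_cast hTpos.ne'
    have n2 : (1 + T : ℂ) ≠ 0 := by
      have : 1 + T ≠ 0 := by positivity
      exact_mod_cast this
    have n3 : z - T ≠ 0 := by
      intro h; apply hz
      have := congrArg Complex.im h
      simpa using this
    have n4 : (π : ℂ) ≠ 0 := by exact_mod_cast Real.pi_ne_zero
    simp only [Complex.real_smul]
    push_cast
    rw [show (-1 : ℂ) - T = -(1 + T) by ring, show (0 : ℂ) - T = -T by ring]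
    field_simp
    ring
  have iall := (((i0.const_mul (-z⁻¹)).add (i1.const_mul (1 + z)⁻¹)).add
    (i2.const_mul (z * (1 + z))⁻¹)).const_mul (((b - 1) / (2 * π) : ℝ) : ℂ)
  constructor
  · rw [integrableOn_Icc_iff_integrableOn_Ioo, ← image_cos m r hr,
      integrableOn_image_iff_integrableOn_abs_deriv_smul measurableSet_Ioo hder hinj,
      integrableOn_congr_fun e measurableSet_Ioo]
    exact iall
  · rw [integral_Icc_eq_integral_Ioo, ← image_cos m r hr,
      integral_image_eq_integral_abs_deriv_smul measurableSet_Ioo hder hinj,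
      setIntegral_congr_fun measurableSet_Ioo e, integral_const_mul,
      integral_add, integral_add, integral_const_mul, integral_const_mul, integral_const_mul,
      v0, v1, v2]
    · have n4 : (π : ℂ) ≠ 0 := by exact_mod_cast Real.pi_ne_zero
      push_cast
      field_simp
    · exact i0.const_mul _
    · exact i1.const_mul _
    · exact (i0.const_mul _).add (i1.const_mul _)
    · exact i2.const_mul _

lemma gamma_prod (a b : ℝ) (ha : 0 < a) (hb : 1 < b) :
    gammaP a b * gammaM a b = ((a - 1) / (b - 1)) ^ 2 := by
  have h1 := Real.sq_sqrt (show 0 ≤ a * b by nlinarith)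
  have h2 := Real.sq_sqrt (show 0 ≤ a + b - 1 by linarith)
  have hb' : b - 1 ≠ 0 := by linarith
  unfold gammaP gammaM
  rw [← mul_pow, div_mul_div_comm, show (√(a * b) + √(a + b - 1)) * (√(a * b) - √(a + b - 1))
    = √(a * b) ^ 2 - √(a + b - 1) ^ 2 by ring, h1, h2]
  field_simp
  ring

lemma gamma_sum (a b : ℝ) (ha : 0 < a) (hb : 1 < b) :
    gammaP a b + gammaM a b = 2 * (a * b + a + b - 1) / (b - 1) ^ 2 := by
  have h1 := Real.sq_sqrt (show 0 ≤ a * b by nlinarith)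
  have h2 := Real.sq_sqrt (show 0 ≤ a + b - 1 by linarith)
  have hb' : b - 1 ≠ 0 := by linarith
  unfold gammaP gammaM
  field_simp
  linear_combination 2 * h1 + 2 * h2

lemma fbp_int (a b m r : ℝ) (hb : 1 < b) (hr : 0 < r) (hmr : 0 ≤ m - r)
    (hP : gammaP a b = m + r) (hM : gammaM a b = m - r)
    (z : ℂ) (hz : z.im ≠ 0) (I : ℂ)
    (h : IntegrableOn (fun t : ℝ => ((b - 1) * Real.sqrt (-((t - (m + r)) * (t - (m - r))))
      / (2 * π * t * (1 + t))) • (z - (t : ℂ))⁻¹) (Set.Icc (m - r) (m + r)) ∧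
    ∫ t in Set.Icc (m - r) (m + r), ((b - 1) * Real.sqrt (-((t - (m + r)) * (t - (m - r))))
      / (2 * π * t * (1 + t))) • (z - (t : ℂ))⁻¹ = I) :
    ∫ t : ℝ, (z - (t : ℂ))⁻¹ ∂(fbp a b) = I + (max (1 - a) 0 : ℝ) * z⁻¹ := by
  obtain ⟨h1, h2⟩ := h
  have hmeas : Measurable (fbpDensity a b) := by
    unfold fbpDensity
    refine Measurable.indicator ?_ measurableSet_Icc
    fun_prop
  have hmeas' : Measurable (fun x => ENNReal.ofReal (fbpDensity a b x)) := hmeas.ennreal_ofReal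
  have hlt : ∀ᵐ x : ℝ, ENNReal.ofReal (fbpDensity a b x) < ⊤ :=
    Filter.Eventually.of_forall fun x => ENNReal.ofReal_lt_top
  have e : (fun t : ℝ => (ENNReal.ofReal (fbpDensity a b t)).toReal • (z - (t : ℂ))⁻¹)
      = Set.indicator (Set.Icc (m - r) (m + r)) (fun t : ℝ =>
        ((b - 1) * Real.sqrt (-((t - (m + r)) * (t - (m - r))))
        / (2 * π * t * (1 + t))) • (z - (t : ℂ))⁻¹) := by
    funext t
    unfold fbpDensity
    rw [hP, hM]
    by_cases ht : t ∈ Set.Icc (m - r) (m + r)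
    · rw [Set.indicator_of_mem ht, Set.indicator_of_mem ht, ENNReal.toReal_ofReal]
      have : 0 ≤ t := hmr.trans ht.1
      have : 0 ≤ b - 1 := by linarith
      positivity
    · rw [Set.indicator_of_notMem ht, Set.indicator_of_notMem ht]
      simp
  unfold fbp
  rw [integral_add_measure, integral_withDensity_eq_integral_toReal_smul hmeas' hlt, e,
    integral_indicator measurableSet_Icc, h2, integral_smul_measure, integral_dirac,
    ENNReal.toReal_ofReal (le_max_right _ _), Complex.real_smul]
  · simp
  · rw [integrable_withDensity_iff_integrable_smul' hmeas' hlt, e]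
    exact h1.integrable_indicator measurableSet_Icc
  · exact (integrable_dirac (by simp)).smul_measure ENNReal.ofReal_ne_top

theorem free_score_fbp (a b x : ℝ) (ha : 0 < a) (hb : 1 < b)
    (hx : x ∈ Set.Ioo (gammaM a b) (gammaP a b)) :
    Tendsto
      (fun ε : ℝ => 2 * (∫ t : ℝ, ((x : ℂ) + ε * Complex.I - (t : ℂ))⁻¹ ∂(fbp a b)).re)
      (nhdsWithin 0 (Set.Ioi 0))
      (nhds (((b + 1) * x + (1 - a)) / (x * (1 + x)))) := by
  obtain ⟨m, hm⟩ : ∃ m, m = (gammaP a b + gammaM a b) / 2 := ⟨_, rfl⟩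
  obtain ⟨r, hrd⟩ : ∃ r, r = (gammaP a b - gammaM a b) / 2 := ⟨_, rfl⟩
  have hP : gammaP a b = m + r := by rw [hm, hrd]; ring
  have hM : gammaM a b = m - r := by rw [hm, hrd]; ring
  have hM0 : 0 ≤ gammaM a b := by unfold gammaM; positivity
  have hr : 0 < r := by rw [hrd]; linarith [hx.1, hx.2]
  have hmr : 0 ≤ m - r := hM ▸ hM0
  have hprod := gamma_prod a b ha hb
  have hsum := gamma_sum a b ha hb
  have hb1 : 0 < b - 1 := by linarith
  rw [hP, hM] at hx hprod hsum
  have hx0 : 0 < x := lt_of_le_of_lt hmr hx.1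
  have s0 : Real.sqrt ((0 - m) ^ 2 - r ^ 2) = |a - 1| / (b - 1) := by
    rw [show (0 - m) ^ 2 - r ^ 2 = (m + r) * (m - r) by ring, hprod, Real.sqrt_sq_eq_abs, abs_div,
      abs_of_pos hb1]
  have s1 : Real.sqrt ((-1 - m) ^ 2 - r ^ 2) = (a + b) / (b - 1) := by
    rw [show (-1 - m) ^ 2 - r ^ 2 = ((a + b) / (b - 1)) ^ 2 by
      rw [show (-1 - m) ^ 2 - r ^ 2 = 1 + (m + r + (m - r)) + (m + r) * (m - r) by ring, hprod, hsum]
      field_simp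
      ring]
    exact Real.sqrt_sq (by positivity)
  obtain ⟨u0, hu0, hu0', hv0⟩ := exists_u_real m r 0 hr (by linarith)
  obtain ⟨u1, hu1, hu1', hv1⟩ := exists_u_real m r (-1) hr (by linarith)
  rw [s0] at hv0
  rw [s1] at hv1
  have hex : ∀ ε : ℝ, ∃ u : ℂ, 0 < ε → ‖u‖ < 1 ∧
      u ^ 2 + 1 = 2 * (((x - m) / r : ℝ) + (ε / r : ℝ) * Complex.I) * u := by
    intro ε
    by_cases h : 0 < ε
    · obtain ⟨u, hu⟩ := exists_u_im (((x - m) / r : ℝ) + (ε / r : ℝ) * Complex.I) (by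
        have : ε / r ≠ 0 := by positivity
        simpa using this)
      exact ⟨u, fun _ => hu⟩
    · exact ⟨0, fun h' => absurd h' h⟩
  choose u hu using hex
  have hr' : (r : ℂ) ≠ 0 := by exact_mod_cast hr.ne'
  have key : ∀ ε : ℝ, 0 < ε → ∫ t : ℝ, ((x : ℂ) + ε * Complex.I - (t : ℂ))⁻¹ ∂(fbp a b)
      = ((b - 1) / 2 : ℝ) * (-(r * u0) * ((x : ℂ) + ε * Complex.I)⁻¹
        + (r * u1) * (1 + ((x : ℂ) + ε * Complex.I))⁻¹
        + (r * u ε) * (((x : ℂ) + ε * Complex.I) * (1 + ((x : ℂ) + ε * Complex.I)))⁻¹)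
        + (max (1 - a) 0 : ℝ) * ((x : ℂ) + ε * Complex.I)⁻¹ := by
    intro ε hε
    obtain ⟨k1, k2⟩ := hu ε hε
    have hz : ((x : ℂ) + ε * Complex.I).im ≠ 0 := by simpa using hε.ne'
    refine fbp_int a b m r hb hr hmr hP hM _ hz _
      (ac_int m r b hr hmr _ hz u0 u1 (u ε) hu0 hu0' hu1 hu1' (Or.inl k1) ?_)
    push_cast at k2
    rw [add_comm (1 : ℂ) (u ε ^ 2), k2]
    field_simp
    ring
  -- continuity ingredients
  have hzt : Tendsto (fun ε : ℝ => (x : ℂ) + ε * Complex.I) (nhdsWithin 0 (Set.Ioi 0)) (nhds (x : ℂ)) := by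
    have : Continuous (fun ε : ℝ => (x : ℂ) + ε * Complex.I) := by fun_prop
    have := (this.tendsto 0).mono_left (nhdsWithin_le_nhds (s := Set.Ioi 0))
    simpa using this
  have nx : (x : ℂ) ≠ 0 := by exact_mod_cast hx0.ne'
  have nx1 : (1 + x : ℂ) ≠ 0 := by
    have : 1 + x ≠ 0 := by positivity
    exact_mod_cast this
  have t1 := hzt.inv₀ nx
  have t2 := (hzt.const_add 1).inv₀ nx1
  have t3 := (hzt.mul (hzt.const_add 1)).inv₀ (mul_ne_zero nx nx1)
  have hxr : ((x - m) / r) ^ 2 < 1 := by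
    rw [div_pow, div_lt_one (by positivity)]
    nlinarith [hx.1, hx.2]
  have tre : Tendsto (fun ε => (u ε).re) (nhdsWithin 0 (Set.Ioi 0)) (nhds ((x - m) / r)) := by
    have hb0 : Tendsto (fun ε : ℝ => Real.sqrt (((x - m) / r) ^ 2 * (ε / r) ^ 2 / (1 - ((x - m) / r) ^ 2)))
        (nhdsWithin 0 (Set.Ioi 0)) (nhds 0) := by
      have : Continuous (fun ε : ℝ => Real.sqrt (((x - m) / r) ^ 2 * (ε / r) ^ 2 / (1 - ((x - m) / r) ^ 2))) := by
        fun_prop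
      have := (this.tendsto 0).mono_left (nhdsWithin_le_nhds (s := Set.Ioi 0))
      simpa using this
    rw [tendsto_iff_dist_tendsto_zero]
    refine squeeze_zero' (Eventually.of_forall fun _ => dist_nonneg) ?_ hb0
    filter_upwards [self_mem_nhdsWithin] with ε hε
    rw [Real.dist_eq]
    exact Real.abs_le_sqrt (re_bound _ _ hxr _ (hu ε hε).2)
  have t4 : Tendsto (fun ε : ℝ => (u ε * (((x : ℂ) + ε * Complex.I) * (1 + ((x : ℂ) + ε * Complex.I)))⁻¹).re)
      (nhdsWithin 0 (Set.Ioi 0)) (nhds ((x - m) / r * (x * (1 + x))⁻¹)) := by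
    have hre := (Complex.continuous_re.tendsto _).comp t3
    have him := (Complex.continuous_im.tendsto _).comp t3
    have er : (((x : ℂ) * (1 + x))⁻¹) = (((x * (1 + x))⁻¹ : ℝ) : ℂ) := by push_cast; ring
    rw [er] at hre him
    rw [Complex.ofReal_re] at hre
    rw [Complex.ofReal_im] at him
    have hz0 : Tendsto (fun ε : ℝ => (u ε).im * ((((x : ℂ) + ε * Complex.I) * (1 + ((x : ℂ) + ε * Complex.I)))⁻¹).im)
        (nhdsWithin 0 (Set.Ioi 0)) (nhds 0) := by
      refine squeeze_zero_norm' ?_ (tendsto_zero_iff_norm_tendsto_zero.mp him)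
      filter_upwards [self_mem_nhdsWithin] with ε hε
      rw [norm_mul]
      have : ‖(u ε).im‖ ≤ 1 := (Complex.abs_im_le_norm _).trans (hu ε hε).1.le
      exact mul_le_of_le_one_left (norm_nonneg _) this
    have := (tre.mul hre).sub hz0
    rw [sub_zero] at this
    exact this
  have t1r := (Complex.continuous_re.tendsto _).comp t1
  have t2r := (Complex.continuous_re.tendsto _).comp t2
  rw [show ((x : ℂ))⁻¹ = ((x⁻¹ : ℝ) : ℂ) by push_cast; ring, Complex.ofReal_re] at t1r
  rw [show ((1 + x : ℂ))⁻¹ = (((1 + x)⁻¹ : ℝ) : ℂ) by push_cast; ring, Complex.ofReal_re] at t2r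
  have tot := ((((t1r.const_mul (-(0 - m + |a - 1| / (b - 1)))).add
    (t2r.const_mul (-1 - m + (a + b) / (b - 1)))).add (t4.const_mul r)).const_mul (b - 1)).add
    (t1r.const_mul (2 * max (1 - a) 0))
  have hval : (b - 1) * (-(0 - m + |a - 1| / (b - 1)) * x⁻¹ + (-1 - m + (a + b) / (b - 1)) * (1 + x)⁻¹
      + r * ((x - m) / r * (x * (1 + x))⁻¹)) + 2 * max (1 - a) 0 * x⁻¹
      = ((b + 1) * x + (1 - a)) / (x * (1 + x)) := by
    have habs : 2 * max (1 - a) 0 = |a - 1| + (1 - a) := by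
      rcases le_total a 1 with h | h
      · rw [max_eq_left (by linarith), abs_of_nonpos (by linarith)]; ring
      · rw [max_eq_right (by linarith), abs_of_nonneg (by linarith)]; ring
    rw [habs]
    have : 1 + x ≠ 0 := by positivity
    field_simp
    ring
  rw [hval] at tot
  refine tot.congr' ?_
  filter_upwards [self_mem_nhdsWithin] with ε hε
  rw [key ε hε, hv0, hv1, mul_assoc (r : ℂ) (u ε)]
  simp only [Function.comp, ← Complex.ofReal_neg, Complex.add_re, Complex.re_ofReal_mul]
  ring
end

section
/- For every real m > 1 and every x in the open interval (−2m/(m−1), 2m/(m−1)), the free score function of the free T distribution equals the derivative of the classical T potential: lim_{ε→0⁺} 2·Re G_{ν_m}(x + iε) = (m+1)x / (m + x²), where ν_m is the probability measure with density f_{fT}(·;m). -/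
open MeasureTheory Real Filter

/-- Density of the free T-distribution of parameter `m`. -/
noncomputable def fTDensity (m : ℝ) : ℝ → ℝ :=
  Set.indicator (Set.Icc (-(2 * m / (m - 1))) (2 * m / (m - 1)))
    (fun x => Real.sqrt (4 - ((m - 1) / m) ^ 2 * x ^ 2) / (2 * π * (1 + x ^ 2 / m)))

/-- The free T-distribution of parameter `m`. -/
noncomputable def fT (m : ℝ) : Measure ℝ :=
  volume.withDensity (fun x => ENNReal.ofReal (fTDensity m x))

lemma aux_ne (w : ℂ) (hw : ‖w‖ < 1) (z : ℂ) (hz : ‖z‖ ≤ 1) : 1 - w * z ≠ 0 := by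
  intro h
  have h1 : w * z = 1 := (sub_eq_zero.mp h).symm
  have h2 : ‖w‖ * ‖z‖ = 1 := by rw [← norm_mul, h1, norm_one]
  nlinarith [norm_nonneg w, norm_nonneg z]

lemma aux_cont (w : ℂ) (hw : ‖w‖ < 1) :
    Continuous (fun θ : ℝ => (1 - w * Complex.exp (θ * Complex.I))⁻¹) := by
  apply Continuous.inv₀ (by fun_prop)
  intro θ
  exact aux_ne w hw _ (Complex.norm_exp_ofReal_mul_I θ).le

lemma aux_mean (w : ℂ) (hw : ‖w‖ < 1) :
    (∫ θ in (-π)..π, (1 - w * Complex.exp (θ * Complex.I))⁻¹) = 2 * π := by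
  have hd : DiffContOnCl ℂ (fun z => (1 - w * z)⁻¹) (Metric.ball 0 |(1:ℝ)|) := by
    apply DifferentiableOn.diffContOnCl
    rw [abs_one, closure_ball _ one_ne_zero]
    intro z hz
    apply DifferentiableAt.differentiableWithinAt
    apply DifferentiableAt.inv (by fun_prop)
    exact aux_ne w hw z (by simpa using hz)
  have h := hd.circleAverage
  rw [circleAverage_eq_integral_add (-π)] at h
  simp only [circleMap, Complex.ofReal_one, one_mul, zero_add] at h
  rw [intervalIntegral.integral_comp_add_right
    (fun θ : ℝ => (1 - w * Complex.exp (θ * Complex.I))⁻¹)] at h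
  have e : 2 * π + -π = π := by ring
  rw [zero_add, e] at h
  simp at h
  have hp : (π : ℂ) ≠ 0 := by exact_mod_cast pi_ne_zero
  field_simp at h
  simpa [mul_comm] using h

lemma aux_half (w : ℂ) (hw : ‖w‖ < 1) :
    (∫ θ in (0:ℝ)..π, ((1 - w * Complex.exp (θ * Complex.I))⁻¹ +
      (1 - w * Complex.exp (((-θ : ℝ) : ℂ) * Complex.I))⁻¹)) = 2 * π := by
  have hc := aux_cont w hw
  have hc2 : Continuous (fun θ : ℝ => (1 - w * Complex.exp (((-θ : ℝ) : ℂ) * Complex.I))⁻¹) :=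
    hc.comp continuous_neg
  rw [← aux_mean w hw, intervalIntegral.integral_add (hc.intervalIntegrable _ _)
    (hc2.intervalIntegrable _ _)]
  rw [intervalIntegral.integral_comp_neg
    (fun θ : ℝ => (1 - w * Complex.exp (θ * Complex.I))⁻¹), neg_zero, add_comm]
  exact intervalIntegral.integral_add_adjacent_intervals (hc.intervalIntegrable _ _)
    (hc.intervalIntegrable _ _)

lemma aux_alg (w E : ℂ) (hw0 : w ≠ 0) (hE : E ≠ 0) (h1 : 1 - w * E ≠ 0) (h2 : 1 - w * E⁻¹ ≠ 0)
   : ((w + w⁻¹) / 2 - (E + E⁻¹) / 2) ≠ 0 ∧ (1 - w ^ 2 ≠ 0 → 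
    (1 - ((E + E⁻¹) / 2) ^ 2) / ((w + w⁻¹) / 2 - (E + E⁻¹) / 2) =
     ((w + w⁻¹) / 2 + (1 - w ^ 2) / (2 * w)) + (E + E⁻¹) / 2
      - (1 - w ^ 2) / (2 * w) * ((1 - w * E)⁻¹ + (1 - w * E⁻¹)⁻¹)) := by
  have key : ((w + w⁻¹) / 2 - (E + E⁻¹) / 2) = (1 - w * E) * (1 - w * E⁻¹) / (2 * w) := by
    field_simp; ring
  have h2' : E - w ≠ 0 := by
    intro h; apply h2; rw [← sub_eq_zero.mp h]; field_simp; simp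
  have h1' : 1 - E * w ≠ 0 := by rwa [mul_comm]
  constructor
  · rw [key]; simp [h1, h2, hw0]
  · intro h3
    rw [key]
    have : 1 - w * E⁻¹ = (E - w) / E := by field_simp
    rw [this, mul_comm w E]
    field_simp
    ring

lemma aux_ne2 (w : ℂ) (hw0 : w ≠ 0) (hw : ‖w‖ < 1) (θ : ℝ) :
    (w + w⁻¹) / 2 - (Real.cos θ : ℂ) ≠ 0 := by
  have := (aux_alg w (Complex.exp (θ * Complex.I)) hw0 (Complex.exp_ne_zero _)
    (aux_ne w hw _ (Complex.norm_exp_ofReal_mul_I θ).le)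
    (by rw [← Complex.exp_neg, ← neg_mul, ← Complex.ofReal_neg]
        exact aux_ne w hw _ (Complex.norm_exp_ofReal_mul_I _).le)).1
  rw [Complex.ofReal_cos, Complex.cos, neg_mul, Complex.exp_neg]
  exact this

lemma aux_cont2 (w : ℂ) (hw0 : w ≠ 0) (hw : ‖w‖ < 1) :
    Continuous (fun θ : ℝ => (Real.sin θ : ℂ) ^ 2 / ((w + w⁻¹) / 2 - (Real.cos θ : ℂ))) := by
  apply Continuous.div (by fun_prop) (by fun_prop)
  exact aux_ne2 w hw0 hw

lemma aux_sin (w : ℂ) (hw0 : w ≠ 0) (hw : ‖w‖ < 1) :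
    (∫ θ in (0:ℝ)..π, (Real.sin θ : ℂ) ^ 2 / ((w + w⁻¹) / 2 - (Real.cos θ : ℂ))) = π * w := by
  have h3 : 1 - w ^ 2 ≠ 0 := by
    have := aux_ne w hw w hw.le
    rwa [← pow_two] at this
  have e : ∀ θ : ℝ, (Real.sin θ : ℂ) ^ 2 / ((w + w⁻¹) / 2 - (Real.cos θ : ℂ)) =
     ((w + w⁻¹) / 2 + (1 - w ^ 2) / (2 * w)) + ((Real.cos θ : ℝ) : ℂ)
      - (1 - w ^ 2) / (2 * w) * ((1 - w * Complex.exp (θ * Complex.I))⁻¹ +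
      (1 - w * Complex.exp (((-θ : ℝ) : ℂ) * Complex.I))⁻¹) := by
    intro θ
    have := (aux_alg w (Complex.exp (θ * Complex.I)) hw0 (Complex.exp_ne_zero _)
      (aux_ne w hw _ (Complex.norm_exp_ofReal_mul_I θ).le)
      (by rw [← Complex.exp_neg, ← neg_mul, ← Complex.ofReal_neg]
          exact aux_ne w hw _ (Complex.norm_exp_ofReal_mul_I _).le)).2 h3
    have hs : (Real.sin θ : ℂ) ^ 2 = 1 - (Real.cos θ : ℂ) ^ 2 := by
      have := Complex.sin_sq_add_cos_sq (θ : ℂ)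
      push_cast; linear_combination this
    rw [hs, Complex.ofReal_cos, Complex.cos, Complex.ofReal_neg, neg_mul, Complex.exp_neg]
    exact this
  simp_rw [e]
  have hc := aux_cont w hw
  rw [intervalIntegral.integral_sub, intervalIntegral.integral_add,
    intervalIntegral.integral_const_mul, aux_half w hw, intervalIntegral.integral_ofReal]
  · simp
    field_simp
    ring
  · exact Continuous.intervalIntegrable (by fun_prop) _ _
  · exact Continuous.intervalIntegrable (by fun_prop) _ _
  · exact Continuous.intervalIntegrable (by fun_prop) _ _
  · exact ((hc.add (hc.comp continuous_neg)).const_mul _).intervalIntegrable _ _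

lemma aux_root (b q : ℝ) (hq : 0 < q) (hb : 1 / q - q = 2 * b) :
    (-(q * Complex.I) + (-(q * Complex.I))⁻¹) / 2 = b * Complex.I ∧
    ((q * Complex.I) + ((q * Complex.I))⁻¹) / 2 = -(b * Complex.I) := by
  have hqc : (q : ℂ) ≠ 0 := by exact_mod_cast hq.ne'
  have hbc : (1 / q - q : ℂ) = 2 * b := by exact_mod_cast hb
  have hb' : (b : ℂ) = (1 / q - q : ℂ) / 2 := by rw [hbc]; ring
  have hi : ((q : ℂ) * Complex.I)⁻¹ = - (1 / q) * Complex.I := by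
    rw [mul_inv, Complex.inv_I]; ring
  constructor
  · rw [inv_neg, hi, hb']; ring
  · rw [hi, hb']; ring

lemma aux_full (b q : ℝ) (hq : 0 < q) (hq1 : q < 1) (hb : 1 / q - q = 2 * b)
    (w u : ℂ) (hw0 : w ≠ 0) (hw : ‖w‖ < 1) (hu : (w + w⁻¹) / 2 = u)
    (hbu : (b : ℂ) ^ 2 + u ^ 2 ≠ 0) :
    (∫ θ in (0:ℝ)..π, (Real.sin θ : ℂ) ^ 2 * (b : ℂ) ^ 2 /
      (((b : ℂ) ^ 2 + (Real.cos θ : ℂ) ^ 2) * (u - (Real.cos θ : ℂ)))) =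
      π * ((b : ℂ) ^ 2 / ((b : ℂ) ^ 2 + u ^ 2) * (w + u * (q / b))) := by
  have hb0 : 0 < b := by
    have : 1 < 1 / q := by rw [lt_div_iff₀ hq]; linarith
    linarith
  have hbc : (b : ℂ) ≠ 0 := by exact_mod_cast hb0.ne'
  have hqc : (q : ℂ) ≠ 0 := by exact_mod_cast hq.ne'
  obtain ⟨r1, r2⟩ := aux_root b q hq hb
  have n1 : (-(q * Complex.I) : ℂ) ≠ 0 := by simp [hqc]
  have n2 : ((q * Complex.I) : ℂ) ≠ 0 := by simp [hqc]
  have m1 : ‖(-(q * Complex.I) : ℂ)‖ < 1 := by simp [abs_of_pos hq, hq1]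
  have m2 : ‖((q * Complex.I) : ℂ)‖ < 1 := by simp [abs_of_pos hq, hq1]
  have i0 := aux_sin w hw0 hw
  have i1 := aux_sin _ n1 m1
  have i2 := aux_sin _ n2 m2
  have c0 := aux_cont2 w hw0 hw
  have c1 := aux_cont2 _ n1 m1
  have c2 := aux_cont2 _ n2 m2
  have d0 := aux_ne2 w hw0 hw
  have d1 := aux_ne2 _ n1 m1
  have d2 := aux_ne2 _ n2 m2
  rw [hu] at i0 c0 d0
  rw [r1] at i1 c1 d1
  rw [r2] at i2 c2 d2
  have e : ∀ θ : ℝ, (Real.sin θ : ℂ) ^ 2 * (b : ℂ) ^ 2 /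
      (((b : ℂ) ^ 2 + (Real.cos θ : ℂ) ^ 2) * (u - (Real.cos θ : ℂ))) =
      (b : ℂ) ^ 2 / ((b : ℂ) ^ 2 + u ^ 2) * ((Real.sin θ : ℂ) ^ 2 / (u - (Real.cos θ : ℂ))
       + (u * (Complex.I / (2 * b)) - 1 / 2) *
          ((Real.sin θ : ℂ) ^ 2 / (b * Complex.I - (Real.cos θ : ℂ)))
       + (-(u * (Complex.I / (2 * b))) - 1 / 2) *
          ((Real.sin θ : ℂ) ^ 2 / (-(b * Complex.I) - (Real.cos θ : ℂ)))) := by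
    intro θ
    have d0 := d0 θ
    have d1 := d1 θ
    have d2 := d2 θ
    generalize (Real.sin θ : ℂ) = s at *
    generalize (Real.cos θ : ℂ) = c at *
    have hI := Complex.I_sq
    have hprod : (b * Complex.I - c) * (-(b * Complex.I) - c) = (b : ℂ) ^ 2 + c ^ 2 := by
      linear_combination (-(b : ℂ) ^ 2) * hI
    have d3 : (b : ℂ) ^ 2 + c ^ 2 ≠ 0 := by
      rw [← hprod]; exact mul_ne_zero d1 d2
    have f1 : s ^ 2 / (b * Complex.I - c) = s ^ 2 * (-(b * Complex.I) - c) / ((b : ℂ) ^ 2 + c ^ 2) := by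
      rw [← hprod]; field_simp
    have f2 : s ^ 2 / (-(b * Complex.I) - c) = s ^ 2 * (b * Complex.I - c) / ((b : ℂ) ^ 2 + c ^ 2) := by
      rw [← hprod]; field_simp
    have f3 : (u * (Complex.I / (2 * b)) - 1 / 2) * (s ^ 2 / (b * Complex.I - c))
       + (-(u * (Complex.I / (2 * b))) - 1 / 2) * (s ^ 2 / (-(b * Complex.I) - c))
       = s ^ 2 * (u + c) / ((b : ℂ) ^ 2 + c ^ 2) := by
      rw [f1, f2]
      field_simp
      linear_combination (-2 * u * s ^ 2 * b) * hI
    rw [add_assoc, f3]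
    field_simp
    ring
  simp_rw [e]
  rw [intervalIntegral.integral_const_mul, intervalIntegral.integral_add, intervalIntegral.integral_add,
    intervalIntegral.integral_const_mul, intervalIntegral.integral_const_mul, i0, i1, i2]
  · have hI := Complex.I_sq
    field_simp
    linear_combination (-2 * u * q) * hI
  · exact c0.intervalIntegrable _ _
  · exact (c1.const_mul _).intervalIntegrable _ _
  · exact (c0.add (c1.const_mul _)).intervalIntegrable _ _
  · exact (c2.const_mul _).intervalIntegrable _ _

/-- Existence of the inverse Joukowski map with quantitative boundary behaviour. -/
lemma aux_w (a δ : ℝ) (ha : a ^ 2 < 1) (hδ : 0 < δ) :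
    ∃ w : ℂ, w ≠ 0 ∧ ‖w‖ < 1 ∧ (w + w⁻¹) / 2 = a + δ * Complex.I ∧
      (w.re - a) ^ 2 * (1 - a ^ 2) ≤ 4 * δ ^ 2 := by
  have key : ∃ w : ℂ, w ≠ 0 ∧ ‖w‖ ≤ 1 ∧ (w + w⁻¹) / 2 = a + δ * Complex.I := by
    set u : ℂ := a + δ * Complex.I with hu
    obtain ⟨v, hv⟩ := IsAlgClosed.exists_pow_nat_eq (u ^ 2 - 1) (n := 2) (by norm_num)
    have hp : (u + v) * (u - v) = 1 := by linear_combination -hv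
    have h1 : u + v ≠ 0 := left_ne_zero_of_mul_eq_one hp
    have h2 : u - v ≠ 0 := right_ne_zero_of_mul_eq_one hp
    rcases le_total ‖u + v‖ 1 with h | h
    · refine ⟨u + v, h1, h, ?_⟩
      rw [← eq_inv_of_mul_eq_one_right hp]; ring
    · refine ⟨u - v, h2, ?_, ?_⟩
      · have : ‖u + v‖ * ‖u - v‖ = 1 := by rw [← norm_mul, hp, norm_one]
        nlinarith [norm_nonneg (u - v)]
      · rw [← eq_inv_of_mul_eq_one_left hp]; ring
  obtain ⟨w, hw0, hw1, hw⟩ := key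
  have hs : ‖w‖ ^ 2 = w.re ^ 2 + w.im ^ 2 := by
    rw [← Complex.normSq_eq_norm_sq, Complex.normSq_apply]; ring
  have hspos : 0 < w.re ^ 2 + w.im ^ 2 := by
    rw [← hs]; have := norm_pos_iff.mpr hw0; positivity
  have hns : Complex.normSq w = w.re ^ 2 + w.im ^ 2 := by rw [Complex.normSq_apply]; ring
  have hw' : w + w⁻¹ = 2 * (a + δ * Complex.I) := by rw [← hw]; ring
  have hre := congrArg Complex.re hw'
  have him := congrArg Complex.im hw'
  simp [Complex.inv_re, Complex.inv_im, hns] at hre him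
  have hsle : w.re ^ 2 + w.im ^ 2 ≤ 1 := by
    rw [← hs]; nlinarith [norm_nonneg w]
  generalize hpd : w.re = p at *
  generalize w.im = y at *
  obtain ⟨s, hsd⟩ : ∃ s, s = p ^ 2 + y ^ 2 := ⟨_, rfl⟩
  rw [← hsd] at hs hspos hre him hsle
  have hs0 : s ≠ 0 := hspos.ne'
  have hre' : p * (1 + s) = 2 * a * s := by field_simp at hre; linarith
  have him' : y * (s - 1) = 2 * δ * s := by field_simp at him; linarith
  have hlt : s < 1 := by
    rcases hsle.lt_or_eq with h | h
    · exact h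
    · rw [h] at him'; linarith
  have hp2 : p ^ 2 ≤ a ^ 2 * s := by
    have h1 : p ^ 2 * (1 + s) ^ 2 = 4 * s * (a ^ 2 * s) := by
      calc p ^ 2 * (1 + s) ^ 2 = (p * (1 + s)) ^ 2 := by ring
        _ = _ := by rw [hre']; ring
    have h2 : 4 * s * p ^ 2 ≤ p ^ 2 * (1 + s) ^ 2 := by nlinarith [mul_nonneg (sq_nonneg p) (sq_nonneg (1 - s))]
    rw [h1] at h2
    exact le_of_mul_le_mul_left h2 (by linarith)
  have hy2 : s * (1 - a ^ 2) ≤ y ^ 2 := by linarith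
  have h3 : (1 - a ^ 2) * (1 - s) ^ 2 ≤ 4 * δ ^ 2 * s := by
    have h1 : y ^ 2 * (1 - s) ^ 2 = s * (4 * δ ^ 2 * s) := by
      calc y ^ 2 * (1 - s) ^ 2 = (y * (s - 1)) ^ 2 := by ring
        _ = _ := by rw [him']; ring
    have h2 : s * (1 - a ^ 2) * (1 - s) ^ 2 ≤ s * (4 * δ ^ 2 * s) := by
      rw [← h1]; exact mul_le_mul_of_nonneg_right hy2 (sq_nonneg _)
    rw [mul_assoc] at h2
    exact le_of_mul_le_mul_left h2 hspos
  refine ⟨w, hw0, ?_, hw, ?_⟩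
  · nlinarith [norm_nonneg w]
  · have h4 : (p - a) * (1 + s) = a * (s - 1) := by linarith
    have h5 : (p - a) ^ 2 * (1 + s) ^ 2 = a ^ 2 * (1 - s) ^ 2 := by
      calc (p - a) ^ 2 * (1 + s) ^ 2 = ((p - a) * (1 + s)) ^ 2 := by ring
        _ = _ := by rw [h4]; ring
    have h6 : (p - a) ^ 2 ≤ (p - a) ^ 2 * (1 + s) ^ 2 :=
      le_mul_of_one_le_right (sq_nonneg _) (by nlinarith)
    have h7 : a ^ 2 * (1 - s) ^ 2 ≤ (1 - s) ^ 2 :=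
      mul_le_of_le_one_left (sq_nonneg _) ha.le
    have h8 : (p - a) ^ 2 * (1 - a ^ 2) ≤ (1 - s) ^ 2 * (1 - a ^ 2) :=
      mul_le_mul_of_nonneg_right (by linarith) (by linarith)
    rw [hpd]
    nlinarith [sq_nonneg δ]

lemma aux_conv (m : ℝ) (hm : 1 < m) (u : ℂ) (hu : 0 < u.im) :
    (∫ t : ℝ, (((2 * m / (m - 1) : ℝ) : ℂ) * u - (t : ℂ))⁻¹ ∂(fT m)) =
    (1 / π) * ∫ θ in (0:ℝ)..π, (Real.sin θ : ℂ) ^ 2 * (((m - 1) / (2 * √m) : ℝ) : ℂ) ^ 2 /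
      (((((m - 1) / (2 * √m) : ℝ) : ℂ) ^ 2 + (Real.cos θ : ℂ) ^ 2) * (u - (Real.cos θ : ℂ))) := by
  have hm0 : 0 < m := by linarith
  have hm1 : 0 < m - 1 := by linarith
  set R : ℝ := 2 * m / (m - 1) with hR
  have hRpos : 0 < R := by positivity
  set h : ℝ → ℝ := fun x => Real.sqrt (4 - ((m - 1) / m) ^ 2 * x ^ 2) / (2 * π * (1 + x ^ 2 / m))
    with hh
  have hhc : Continuous h := by
    apply Continuous.div (by fun_prop) (by fun_prop)
    intro x; positivity
  have hnn : ∀ x, 0 ≤ fTDensity m x := by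
    intro x
    apply Set.indicator_nonneg
    intro y _; positivity
  have hmeas : Measurable (fTDensity m) := hhc.measurable.indicator measurableSet_Icc
  have hzne : ∀ t : ℝ, (R : ℂ) * u - (t : ℂ) ≠ 0 := by
    intro t ht
    have := congrArg Complex.im ht
    simp at this
    rcases this with h | h <;> linarith
  have hgc : Continuous (fun t : ℝ => h t • ((R : ℂ) * u - (t : ℂ))⁻¹) := by
    apply hhc.smul
    exact Continuous.inv₀ (by fun_prop) hzne
  rw [fT, integral_withDensity_eq_integral_toReal_smul hmeas.ennreal_ofReal
    (Eventually.of_forall fun _ => ENNReal.ofReal_lt_top)]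
  simp_rw [ENNReal.toReal_ofReal (hnn _)]
  have e1 : ∀ t : ℝ, fTDensity m t • ((R : ℂ) * u - (t : ℂ))⁻¹ =
      (Set.Icc (-R) R).indicator (fun t : ℝ => h t • ((R : ℂ) * u - (t : ℂ))⁻¹) t := by
    intro t
    rw [Set.indicator_smul_apply_left]
    rfl
  simp_rw [e1]
  rw [integral_indicator measurableSet_Icc, integral_Icc_eq_integral_Ioc,
    ← intervalIntegral.integral_of_le (by linarith)]
  have hsub := intervalIntegral.integral_deriv_smul_comp (a := 0) (b := π)
    (f := fun θ => R * Real.cos θ) (f' := fun θ => R * (-Real.sin θ))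
    (fun θ _ => (Real.hasDerivAt_cos θ).const_mul R) (by fun_prop) hgc
  simp only [Real.cos_zero, Real.cos_pi, mul_one, mul_neg] at hsub
  rw [intervalIntegral.integral_symm, ← hsub, ← intervalIntegral.integral_neg,
    ← intervalIntegral.integral_const_mul]
  apply intervalIntegral.integral_congr
  intro θ hθ
  rw [Set.uIcc_of_le pi_pos.le] at hθ
  have hs0 : 0 ≤ Real.sin θ := Real.sin_nonneg_of_mem_Icc hθ
  have hsq : Real.sqrt (4 - ((m - 1) / m) ^ 2 * (R * Real.cos θ) ^ 2) = 2 * Real.sin θ := by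
    have : 4 - ((m - 1) / m) ^ 2 * (R * Real.cos θ) ^ 2 = (2 * Real.sin θ) ^ 2 := by
      have h1 : (m - 1) / m * R = 2 := by rw [hR]; field_simp
      calc 4 - ((m - 1) / m) ^ 2 * (R * Real.cos θ) ^ 2
          = 4 - ((m - 1) / m * R) ^ 2 * Real.cos θ ^ 2 := by ring
        _ = _ := by rw [h1]; linear_combination (-4) * Real.sin_sq_add_cos_sq θ
    rw [this, Real.sqrt_sq (by linarith)]
  have hb2 : ((m - 1) / (2 * √m)) ^ 2 = (m - 1) ^ 2 / (4 * m) := by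
    rw [div_pow, mul_pow, Real.sq_sqrt hm0.le]; norm_num
  have hRc : (R : ℂ) ≠ 0 := by exact_mod_cast hRpos.ne'
  have hinv : ((R : ℂ) * u - ((R * Real.cos θ : ℝ) : ℂ))⁻¹ =
      (R : ℂ)⁻¹ * (u - (Real.cos θ : ℂ))⁻¹ := by
    rw [← mul_inv]; push_cast; ring_nf
  have hreal : R * Real.sin θ * h (R * Real.cos θ) * R⁻¹ =
      1 / π * (Real.sin θ ^ 2 * ((m - 1) / (2 * √m)) ^ 2 /
        (((m - 1) / (2 * √m)) ^ 2 + Real.cos θ ^ 2)) := by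
    have hpos : 0 < (m - 1) ^ 2 + 4 * m * Real.cos θ ^ 2 := by positivity
    simp only [hh]
    rw [hsq, hb2, hR]
    field_simp
    ring
  simp only [Function.comp, Complex.real_smul]
  rw [hinv]
  calc _ = ((R * Real.sin θ * h (R * Real.cos θ) * R⁻¹ : ℝ) : ℂ) * (u - (Real.cos θ : ℂ))⁻¹ := by
        push_cast; ring
    _ = _ := by
        rw [hreal]
        generalize (m - 1) / (2 * √m) = bb
        push_cast
        simp only [div_eq_mul_inv, mul_inv, one_mul]
        ring

theorem free_score_fT (m x : ℝ) (hm : 1 < m)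
    (hx : x ∈ Set.Ioo (-(2 * m / (m - 1))) (2 * m / (m - 1))) :
    Tendsto
      (fun ε : ℝ => 2 * (∫ t : ℝ, ((x : ℂ) + ε * Complex.I - (t : ℂ))⁻¹ ∂(fT m)).re)
      (nhdsWithin 0 (Set.Ioi 0))
      (nhds ((m + 1) * x / (m + x ^ 2))) := by
  have hm0 : 0 < m := by linarith
  have hm1 : 0 < m - 1 := by linarith
  obtain ⟨R, hR⟩ : ∃ R : ℝ, R = 2 * m / (m - 1) := ⟨_, rfl⟩
  rw [← hR] at hx
  have hRpos : 0 < R := by rw [hR]; positivity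
  obtain ⟨a, ha⟩ : ∃ a : ℝ, a = x / R := ⟨_, rfl⟩
  have hxa : x = R * a := by rw [ha]; field_simp
  have ha1 : a ^ 2 < 1 := by
    have h1 : a < 1 := by rw [ha, div_lt_one hRpos]; exact hx.2
    have h2 : -1 < a := by rw [ha, lt_div_iff₀ hRpos]; linarith [hx.1]
    nlinarith
  obtain ⟨b, hb⟩ : ∃ b : ℝ, b = (m - 1) / (2 * √m) := ⟨_, rfl⟩
  have hsm : 0 < √m := Real.sqrt_pos.mpr hm0
  have hb0 : 0 < b := by rw [hb]; positivity
  have hb2 : b ^ 2 = (m - 1) ^ 2 / (4 * m) := by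
    rw [hb, div_pow, mul_pow, Real.sq_sqrt hm0.le]; norm_num
  have hq1 : (√m)⁻¹ < 1 := inv_lt_one_of_one_lt₀ (by rw [Real.lt_sqrt] <;> linarith)
  have hqb : 1 / (√m)⁻¹ - (√m)⁻¹ = 2 * b := by
    rw [hb]; field_simp; rw [Real.sq_sqrt hm0.le]
  have hW : ∀ ε : ℝ, ∃ w : ℂ, 0 < ε → (w ≠ 0 ∧ ‖w‖ < 1 ∧
      (w + w⁻¹) / 2 = a + ((ε / R : ℝ) : ℂ) * Complex.I ∧
      (w.re - a) ^ 2 * (1 - a ^ 2) ≤ 4 * (ε / R) ^ 2) := by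
    intro ε
    by_cases hε : 0 < ε
    · obtain ⟨w, hw⟩ := aux_w a (ε / R) ha1 (by positivity)
      exact ⟨w, fun _ => hw⟩
    · exact ⟨0, fun h => absurd h hε⟩
  choose W hW using hW
  let u : ℝ → ℂ := fun ε => a + ((ε / R : ℝ) : ℂ) * Complex.I
  let A : ℝ → ℂ := fun ε => (b : ℂ) ^ 2 / ((b : ℂ) ^ 2 + u ε ^ 2)
  have hden0 : ((b : ℂ) ^ 2 + u 0 ^ 2) ≠ 0 := by
    have : ((b ^ 2 + a ^ 2 : ℝ) : ℂ) ≠ 0 := by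
      have : 0 < b ^ 2 + a ^ 2 := by positivity
      exact_mod_cast this.ne'
    simpa [u] using this
  have hdenc : Continuous (fun ε => (b : ℂ) ^ 2 + u ε ^ 2) := by
    simp only [u]; fun_prop
  have hAc : ContinuousAt A 0 := ContinuousAt.div continuousAt_const hdenc.continuousAt hden0
  have hA0 : A 0 = ((b ^ 2 / (b ^ 2 + a ^ 2) : ℝ) : ℂ) := by simp [A, u]
  have hAt : Tendsto A (nhdsWithin 0 (Set.Ioi 0)) (nhds ((b ^ 2 / (b ^ 2 + a ^ 2) : ℝ) : ℂ)) := by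
    rw [← hA0]; exact hAc.tendsto.mono_left nhdsWithin_le_nhds
  have hAre : Tendsto (fun ε => (A ε).re) (nhdsWithin 0 (Set.Ioi 0))
      (nhds (b ^ 2 / (b ^ 2 + a ^ 2))) := by
    have := (Complex.continuous_re.tendsto _).comp hAt
    rwa [Complex.ofReal_re] at this
  have hAim : Tendsto (fun ε => (A ε).im) (nhdsWithin 0 (Set.Ioi 0)) (nhds 0) := by
    have := (Complex.continuous_im.tendsto _).comp hAt
    rwa [Complex.ofReal_im] at this
  have hpos : ∀ᶠ ε : ℝ in nhdsWithin 0 (Set.Ioi 0), 0 < ε := self_mem_nhdsWithin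
  have hden : ∀ᶠ ε : ℝ in nhdsWithin 0 (Set.Ioi 0), (b : ℂ) ^ 2 + u ε ^ 2 ≠ 0 :=
    nhdsWithin_le_nhds (hdenc.continuousAt.eventually_ne hden0)
  have hWre : Tendsto (fun ε => (W ε).re) (nhdsWithin 0 (Set.Ioi 0)) (nhds a) := by
    rw [tendsto_iff_norm_sub_tendsto_zero]
    have hlim : Tendsto (fun ε : ℝ => √(4 * (ε / R) ^ 2 / (1 - a ^ 2)))
        (nhdsWithin 0 (Set.Ioi 0)) (nhds 0) := by
      have hc : Continuous (fun ε : ℝ => √(4 * (ε / R) ^ 2 / (1 - a ^ 2))) := by fun_prop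
      have h0 := hc.tendsto 0
      have h1 : √(4 * (0 / R) ^ 2 / (1 - a ^ 2)) = 0 := by simp
      rw [h1] at h0
      exact h0.mono_left nhdsWithin_le_nhds
    refine squeeze_zero' (Eventually.of_forall fun _ => norm_nonneg _) ?_ hlim
    filter_upwards [hpos] with ε hε
    rw [Real.norm_eq_abs]
    apply Real.abs_le_sqrt
    rw [le_div_iff₀ (by linarith)]
    exact (hW ε hε).2.2.2
  have hWim : Tendsto (fun ε => (A ε).im * (W ε).im) (nhdsWithin 0 (Set.Ioi 0)) (nhds 0) := by
    refine squeeze_zero_norm' (a := fun ε => ‖(A ε).im‖) ?_ (by simpa using hAim.norm)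
    filter_upwards [hpos] with ε hε
    rw [norm_mul]
    apply mul_le_of_le_one_right (norm_nonneg _)
    exact (Complex.abs_im_le_norm _).trans (hW ε hε).2.1.le
  have hlim0 : Tendsto (fun ε : ℝ => (A ε).im * (ε / R * (2 / (m - 1))))
      (nhdsWithin 0 (Set.Ioi 0)) (nhds 0) := by
    have hc : Continuous (fun ε : ℝ => ε / R * (2 / (m - 1))) := by fun_prop
    have := hAim.mul ((hc.tendsto 0).mono_left (nhdsWithin_le_nhds (s := Set.Ioi 0)))
    simpa using this
  have hfin := (((hAre.mul (hWre.add_const (a * (2 / (m - 1))))).sub (hWim.add hlim0))).const_mul 2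
  have hval : 2 * (b ^ 2 / (b ^ 2 + a ^ 2) * (a + a * (2 / (m - 1))) - (0 + 0))
      = (m + 1) * x / (m + x ^ 2) := by
    have : 0 < (m - 1) ^ 2 + 4 * m * a ^ 2 := by positivity
    rw [hb2, hxa, hR]
    field_simp
    ring
  rw [hval] at hfin
  refine hfin.congr' ?_
  filter_upwards [hpos, hden] with ε hε hd
  obtain ⟨w0, w1, w2, -⟩ := hW ε hε
  have hui : 0 < (u ε).im := by
    have : (u ε).im = ε / R := by simp [u, -Complex.ofReal_div]
    rw [this]; positivity
  have hz : ∀ t : ℝ, (x : ℂ) + ε * Complex.I - (t : ℂ) = ((2 * m / (m - 1) : ℝ) : ℂ) * u ε - t := by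
    intro t
    rw [← hR, hxa]
    have hRc : (R : ℂ) ≠ 0 := by exact_mod_cast hRpos.ne'
    simp only [u]
    push_cast
    field_simp
  simp_rw [hz]
  rw [aux_conv m hm (u ε) hui, ← hb,
    aux_full b (√m)⁻¹ (by positivity) hq1 hqb (W ε) (u ε) w0 w1 w2 hd]
  have hpc : (π : ℂ) ≠ 0 := by exact_mod_cast pi_ne_zero
  rw [← mul_assoc (1 / (π : ℂ)), one_div_mul_cancel hpc, one_mul]
  have hqd : (((√m)⁻¹ : ℝ) : ℂ) / (b : ℂ) = ((2 / (m - 1) : ℝ) : ℂ) := by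
    rw [← Complex.ofReal_div]
    congr 1
    rw [hb]; field_simp
  rw [hqd]
  change _ = 2 * (A ε * (W ε + u ε * _)).re
  rw [Complex.mul_re, Complex.add_re, Complex.add_im, Complex.re_mul_ofReal, Complex.im_mul_ofReal]
  simp [u, -Complex.ofReal_div]
  ring
end

section
/- For all real parameters a > 0, b > 0 with a + b > 1 and every x in the open interval (κ₋, κ₊), the free score function of the free beta distribution equals the derivative of the classical beta potential: lim_{ε→0⁺} 2·Re G_{υ_{a,b}}(x + iε) = ((a+b−2)x + (1−a)) / (x(1−x)). -/
open MeasureTheory Real Filter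

lemma fb_D_fac (u : ℂ) (θ : ℝ) : 1 - 2 * u * Complex.cos θ + u ^ 2 =
    (1 - u * Complex.exp (θ * Complex.I)) * (1 - u * Complex.exp (-θ * Complex.I)) := by
  have h1 := Complex.exp_mul_I (θ : ℂ)
  have h2 := Complex.exp_mul_I (-(θ : ℂ))
  rw [h1, h2, Complex.cos_neg, Complex.sin_neg]
  have h3 := Complex.sin_sq_add_cos_sq (θ : ℂ)
  linear_combination (-u^2) * h3 + u ^ 2 * Complex.sin θ ^ 2 * Complex.I_sq

lemma fb_ne (u : ℂ) (hu : ‖u‖ < 1) (z : ℂ) (hz : ‖z‖ ≤ 1) : 1 - u * z ≠ 0 := by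
  intro h
  have h1 : u * z = 1 := by linear_combination -h
  have h2 : ‖u‖ * ‖z‖ = 1 := by rw [← norm_mul, h1, norm_one]
  nlinarith [norm_nonneg u, norm_nonneg z]

lemma fb_expnorm (θ : ℝ) : ‖Complex.exp (θ * Complex.I)‖ ≤ 1 := by
  rw [Complex.norm_exp_ofReal_mul_I]

lemma fb_expnorm' (θ : ℝ) : ‖Complex.exp (-θ * Complex.I)‖ ≤ 1 := by
  have := fb_expnorm (-θ)
  simpa using this

lemma fb_D_ne (u : ℂ) (hu : ‖u‖ < 1) (θ : ℝ) : 1 - 2 * u * Complex.cos θ + u ^ 2 ≠ 0 := by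
  rw [fb_D_fac]
  exact mul_ne_zero (fb_ne u hu _ (fb_expnorm θ)) (fb_ne u hu _ (fb_expnorm' θ))

lemma fb_g_eq (u : ℂ) (hu : ‖u‖ < 1) (θ : ℝ) :
    Complex.sin θ ^ 2 / (1 - 2 * u * Complex.cos θ + u ^ 2) =
    (-1/4) * (((Complex.exp (θ * Complex.I)) ^ 2 - 1) / (1 - u * Complex.exp (θ * Complex.I)) +
      ((Complex.exp (-θ * Complex.I)) ^ 2 - 1) / (1 - u * Complex.exp (-θ * Complex.I))) := by
  rw [fb_D_fac]
  have n1 := fb_ne u hu _ (fb_expnorm θ)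
  have n2 := fb_ne u hu _ (fb_expnorm' θ)
  have hs : Complex.sin θ ^ 2 = (-1/4) * (Complex.exp (θ * Complex.I) - Complex.exp (-θ * Complex.I)) ^ 2 := by
    rw [Complex.exp_mul_I, Complex.exp_mul_I, Complex.cos_neg, Complex.sin_neg]
    linear_combination (Complex.sin θ) ^ 2 * Complex.I_sq
  have he : Complex.exp (θ * Complex.I) * Complex.exp (-θ * Complex.I) = 1 := by
    rw [← Complex.exp_add]; simp
  rw [hs]
  generalize Complex.exp (θ * Complex.I) = p at *
  generalize Complex.exp (-θ * Complex.I) = q at *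
  rw [div_add_div _ _ n1 n2, ← mul_div_assoc]
  congr 1
  linear_combination (-1/4) * (u * (p + q) - 2) * he

lemma fb_F (u : ℂ) (hu : ‖u‖ < 1) :
    ∫ θ in (0:ℝ)..π, Complex.sin θ ^ 2 / (1 - 2 * u * Complex.cos θ + u ^ 2) = (π : ℂ) / 2 := by
  let h : ℝ → ℂ := fun θ =>
    ((Complex.exp (θ * Complex.I)) ^ 2 - 1) / (1 - u * Complex.exp (θ * Complex.I))
  have hc : Continuous h := by
    apply Continuous.div (by fun_prop) (by fun_prop)
    exact fun θ => fb_ne u hu _ (fb_expnorm θ)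
  have hper : Function.Periodic h (2 * π) := by
    intro θ
    simp only [h]
    have : Complex.exp (((θ + 2 * π : ℝ) : ℂ) * Complex.I) = Complex.exp (θ * Complex.I) := by
      push_cast
      rw [add_mul, Complex.exp_add, Complex.exp_two_pi_mul_I, mul_one]
    rw [this]
  have hmean : ∫ θ in (0:ℝ)..2 * π, h θ = -(2 * π) := by
    have := circleAverage_of_differentiable_on_off_countable (f := fun z : ℂ => (z ^ 2 - 1) / (1 - u * z))
      (c := 0) (R := 1) (s := ∅) Set.countable_empty
      (by
        apply ContinuousOn.div (by fun_prop) (by fun_prop)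
        intro z hz
        exact fb_ne u hu z (by simpa using hz))
      (by
        intro z hz
        have hz' : ‖z‖ < 1 := by simpa using hz
        exact DifferentiableAt.div (by fun_prop) (by fun_prop) (fb_ne u hu z hz'.le))
    rw [Real.circleAverage_def] at this
    simp only [circleMap, zero_add, Complex.ofReal_one, one_mul] at this
    change (2 * π)⁻¹ • (∫ θ in (0:ℝ)..2 * π, h θ) = _ at this
    rw [inv_smul_eq_iff₀ (by positivity)] at this
    rw [this]
    simp
  have e1 : ∀ θ : ℝ, Complex.sin θ ^ 2 / (1 - 2 * u * Complex.cos θ + u ^ 2)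
      = (-1/4) * (h θ + h (-θ)) := by
    intro θ
    rw [fb_g_eq u hu]
    simp [h]
  simp_rw [e1]
  have hc2 : Continuous (fun θ => h (-θ)) := hc.comp continuous_neg
  rw [intervalIntegral.integral_const_mul, intervalIntegral.integral_add
    (hc.intervalIntegrable _ _) (hc2.intervalIntegrable _ _),
    intervalIntegral.integral_comp_neg, neg_zero, add_comm,
    intervalIntegral.integral_add_adjacent_intervals (hc.intervalIntegrable _ _) (hc.intervalIntegrable _ _)]
  have := hper.intervalIntegral_add_eq (-π) 0
  rw [show -π + 2 * π = π by ring, zero_add] at this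
  rw [this, hmean]
  ring

lemma fb_F_set (u : ℂ) (hu : ‖u‖ < 1 ∨ u = 1 ∨ u = -1) :
    IntegrableOn (fun θ : ℝ => Complex.sin θ ^ 2 / (1 - 2 * u * Complex.cos θ + u ^ 2)) (Set.Ioo 0 π) ∧
    ∫ θ in Set.Ioo (0:ℝ) π, Complex.sin θ ^ 2 / (1 - 2 * u * Complex.cos θ + u ^ 2) = (π : ℂ) / 2 := by
  have key : ∀ f : ℝ → ℂ, Continuous f → (∫ θ in (0:ℝ)..π, f θ) = (π : ℂ) / 2 →
      IntegrableOn f (Set.Ioo 0 π) ∧ ∫ θ in Set.Ioo (0:ℝ) π, f θ = (π : ℂ) / 2 := by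
    intro f hf h
    refine ⟨(hf.integrableOn_Icc).mono_set Set.Ioo_subset_Icc_self, ?_⟩
    rw [← integral_Ioc_eq_integral_Ioo, ← intervalIntegral.integral_of_le pi_pos.le, h]
  have key2 : ∀ s : ℂ, s ^ 2 = 1 → u = s → (∀ θ ∈ Set.Ioo (0:ℝ) π, 1 - s * Complex.cos θ ≠ 0) →
     IntegrableOn (fun θ : ℝ => Complex.sin θ ^ 2 / (1 - 2 * u * Complex.cos θ + u ^ 2)) (Set.Ioo 0 π) ∧
    ∫ θ in Set.Ioo (0:ℝ) π, Complex.sin θ ^ 2 / (1 - 2 * u * Complex.cos θ + u ^ 2) = (π : ℂ) / 2 := by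
    rintro s hs rfl hne
    have e : Set.EqOn (fun θ : ℝ => Complex.sin θ ^ 2 / (1 - 2 * u * Complex.cos θ + u ^ 2))
       (fun θ : ℝ => (1 + u * Complex.cos θ) / 2) (Set.Ioo 0 π) := by
      intro θ hθ
      have := hne θ hθ
      have h2 : 1 - 2 * u * Complex.cos θ + u ^ 2 = 2 * (1 - u * Complex.cos θ) := by
        rw [hs]; ring
      simp only []
      rw [h2, div_eq_div_iff (mul_ne_zero two_ne_zero this) two_ne_zero]
      linear_combination 2 * Complex.sin_sq_add_cos_sq (θ : ℂ) + 2 * (Complex.cos θ) ^ 2 * hs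
    rw [setIntegral_congr_fun measurableSet_Ioo e, integrableOn_congr_fun e measurableSet_Ioo]
    apply key _ (by fun_prop)
    simp_rw [← Complex.ofReal_cos]
    rw [intervalIntegral.integral_div, intervalIntegral.integral_add (by simp)
      (Continuous.intervalIntegrable (by fun_prop) _ _), intervalIntegral.integral_const_mul,
      intervalIntegral.integral_ofReal]
    simp
  rcases hu with hu | hu | hu
  · apply key _ _ (fb_F u hu)
    exact Continuous.div (by fun_prop) (by fun_prop) (fb_D_ne u hu)
  · apply key2 1 (by norm_num) hu
    intro θ hθ h
    rw [← Complex.ofReal_cos] at h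
    have h' : 1 - 1 * Real.cos θ = 0 := by exact_mod_cast h
    have h3 := Real.sin_pos_of_mem_Ioo hθ
    nlinarith [Real.sin_sq_add_cos_sq θ]
  · apply key2 (-1) (by norm_num) hu
    intro θ hθ h
    rw [← Complex.ofReal_cos] at h
    have h' : 1 - (-1) * Real.cos θ = 0 := by exact_mod_cast h
    have h3 := Real.sin_pos_of_mem_Ioo hθ
    nlinarith [Real.sin_sq_add_cos_sq θ]

/-- Stieltjes transform of the semicircle by Joukowski parametrization. -/
lemma fb_S (c d : ℝ) (hcd : c < d) (z u : ℂ) (hu : ‖u‖ < 1 ∨ u = 1 ∨ u = -1)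
    (hz : ((d - c) / 2 : ℂ) * (u ^ 2 + 1) = 2 * u * (z - (c + d) / 2)) :
    IntegrableOn (fun t : ℝ => (Real.sqrt (-((t - d) * (t - c))) : ℂ) * (z - t)⁻¹) (Set.Ioo c d) ∧
    ∫ t in Set.Ioo c d, (Real.sqrt (-((t - d) * (t - c))) : ℂ) * (z - t)⁻¹ = π * ((d - c) / 2) * u := by
  set r : ℝ := (d - c) / 2 with hr
  set m : ℝ := (c + d) / 2 with hm
  have hr0 : 0 < r := by rw [hr]; linarith
  have hrc : (r : ℂ) ≠ 0 := by exact_mod_cast hr0.ne'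
  have hu0 : u ≠ 0 := by
    rintro rfl
    have : ((d - c) / 2 : ℂ) = r := by rw [hr]; push_cast; ring
    rw [this] at hz
    simp at hz
    exact hr0.ne' hz
  have himg : (fun θ : ℝ => m + r * Real.cos θ) '' Set.Ioo 0 π = Set.Ioo c d := by
    ext t
    constructor
    · rintro ⟨θ, hθ, rfl⟩
      have h3 := Real.sin_pos_of_mem_Ioo hθ
      have h4 := Real.sin_sq_add_cos_sq θ
      have : -1 < Real.cos θ := by nlinarith
      have : Real.cos θ < 1 := by nlinarith
      constructor <;> simp only [hr, hm] <;> nlinarith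
    · rintro ⟨h1, h2⟩
      have e1 : -1 < (t - m) / r := by rw [lt_div_iff₀ hr0]; simp only [hr, hm]; linarith
      have e2 : (t - m) / r < 1 := by rw [div_lt_iff₀ hr0]; simp only [hr, hm]; linarith
      refine ⟨Real.arccos ((t - m) / r), ⟨Real.arccos_pos.2 e2, ?_⟩, ?_⟩
      · rcases (Real.arccos_le_pi ((t - m) / r)).lt_or_eq with h | h
        · exact h
        · rw [Real.arccos_eq_pi] at h; linarith
      · simp only []
        rw [Real.cos_arccos e1.le e2.le]
        field_simp
        ring
  have hinj : Set.InjOn (fun θ : ℝ => m + r * Real.cos θ) (Set.Ioo 0 π) := by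
    intro p hp q hq h
    simp only [] at h
    have : Real.cos p = Real.cos q := by
      have : r * Real.cos p = r * Real.cos q := by linarith
      exact mul_left_cancel₀ hr0.ne' this
    exact Real.injOn_cos ⟨hp.1.le, hp.2.le⟩ ⟨hq.1.le, hq.2.le⟩ this
  have hder : ∀ θ ∈ Set.Ioo 0 π, HasDerivWithinAt (fun θ : ℝ => m + r * Real.cos θ)
      (-(r * Real.sin θ)) (Set.Ioo 0 π) θ := by
    intro θ _
    have := ((Real.hasDerivAt_cos θ).const_mul r).const_add m
    exact (this.congr_deriv (by ring)).hasDerivWithinAt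
  have e : Set.EqOn (fun θ : ℝ => |-(r * Real.sin θ)| • ((Real.sqrt (-((m + r * Real.cos θ - d) * (m + r * Real.cos θ - c))) : ℂ) * (z - (m + r * Real.cos θ : ℝ))⁻¹))
      (fun θ : ℝ => (2 * r * u) * (Complex.sin θ ^ 2 / (1 - 2 * u * Complex.cos θ + u ^ 2))) (Set.Ioo 0 π) := by
    intro θ hθ
    have h3 := Real.sin_pos_of_mem_Ioo hθ
    have h4 := Real.sin_sq_add_cos_sq θ
    have hs : Real.sqrt (-((m + r * Real.cos θ - d) * (m + r * Real.cos θ - c))) = r * Real.sin θ := by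
      rw [show -((m + r * Real.cos θ - d) * (m + r * Real.cos θ - c)) = (r * Real.sin θ) ^ 2 by
        rw [mul_pow, show Real.sin θ ^ 2 = 1 - Real.cos θ ^ 2 by linarith]; simp only [hr, hm]; ring]
      exact Real.sqrt_sq (by positivity)
    simp only []
    rw [hs, abs_neg, abs_of_pos (by positivity)]
    have hD : (1 - 2 * u * Complex.cos θ + u ^ 2) * r = 2 * u * (z - (m + r * Real.cos θ : ℝ)) := by
      simp only [hr, hm] 
      push_cast
      linear_combination hz
    have hD' : (1 - 2 * u * Complex.cos θ + u ^ 2) = 2 * u * (z - (m + r * Real.cos θ : ℝ)) / r := by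
      rw [← hD]; field_simp
    rw [hD']
    rw [Complex.real_smul]
    push_cast
    generalize (z - (m + r * Complex.cos θ)) = y
    by_cases hy : y = 0
    · simp [hy]
    · field_simp
  have hF := fb_F_set u hu
  rw [← himg]
  rw [integrableOn_image_iff_integrableOn_abs_deriv_smul measurableSet_Ioo hder hinj,
    integral_image_eq_integral_abs_deriv_smul measurableSet_Ioo hder hinj,
    integrableOn_congr_fun e measurableSet_Ioo, setIntegral_congr_fun measurableSet_Ioo e]
  refine ⟨hF.1.const_mul _, ?_⟩
  rw [integral_const_mul, hF.2]
  simp only [hr]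
  push_cast
  ring

lemma fb_params (a b : ℝ) (ha : 0 < a) (hb : 0 < b) (hab : 1 < a + b) :
    0 ≤ kappaM a b ∧ kappaP a b ≤ 1 ∧
    (|a - 1| / (a + b)) ^ 2 = kappaM a b * kappaP a b ∧
    (|b - 1| / (a + b)) ^ 2 = (1 - kappaM a b) * (1 - kappaP a b) := by
  have hn : 0 < a + b := by linarith
  have hA : Real.sqrt (a * (a + b - 1)) ^ 2 = a * (a + b - 1) :=
    Real.sq_sqrt (by apply mul_nonneg <;> linarith)
  have hB : Real.sqrt b ^ 2 = b := Real.sq_sqrt hb.le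
  have hprod : kappaM a b * kappaP a b = ((a - 1) / (a + b)) ^ 2 := by
    unfold kappaM kappaP
    generalize Real.sqrt (a * (a + b - 1)) = A at *
    generalize Real.sqrt b = B at *
    have : (A - B) / (a + b) * ((A + B) / (a + b)) = (a - 1) / (a + b) := by
      field_simp
      linear_combination hA - hB
    rw [← mul_pow, this]
  have hsum : kappaM a b + kappaP a b = 2 * (a * (a + b - 1) + b) / (a + b) ^ 2 := by
    unfold kappaM kappaP
    generalize Real.sqrt (a * (a + b - 1)) = A at *
    generalize Real.sqrt b = B at *
    field_simp
    linear_combination 2 * hA + 2 * hB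
  have h1 : (|b - 1| / (a + b)) ^ 2 = (1 - kappaM a b) * (1 - kappaP a b) := by
    rw [show (1 - kappaM a b) * (1 - kappaP a b) = 1 - (kappaM a b + kappaP a b) + kappaM a b * kappaP a b by ring, hprod, hsum, div_pow, sq_abs]
    field_simp
    ring
  have h2 : kappaM a b + kappaP a b < 2 := by
    rw [hsum, div_lt_iff₀ (by positivity)]
    nlinarith [mul_pos hb (by linarith : 0 < a + b - 1)]
  refine ⟨by unfold kappaM; positivity, ?_, ?_, h1⟩
  · by_contra! h
    have : 0 ≤ (1 - kappaM a b) * (1 - kappaP a b) := by rw [← h1]; positivity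
    nlinarith
  · rw [hprod, div_pow, sq_abs, div_pow]

lemma fb_S0 (c d p : ℝ) (hc : 0 ≤ c) (hcd : c < d) (hp : 0 ≤ p) (hpp : p ^ 2 = c * d) :
    IntegrableOn (fun t : ℝ => (Real.sqrt (-((t - d) * (t - c))) : ℂ) * (0 - (t : ℂ))⁻¹) (Set.Ioo c d) ∧
    ∫ t in Set.Ioo c d, (Real.sqrt (-((t - d) * (t - c))) : ℂ) * (0 - (t : ℂ))⁻¹
      = π * (-((c + d) / 2) + p : ℝ) := by
  have hr : 0 < (d - c) / 2 := by linarith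
  have hdc : (d : ℂ) - c ≠ 0 := by
    rw [← Complex.ofReal_sub]; exact_mod_cast (by linarith : (0:ℝ) < d - c).ne'
  have hpp' : (p : ℂ) ^ 2 = c * d := by exact_mod_cast hpp
  have := fb_S c d hcd 0 ((((-((c + d) / 2) + p) / ((d - c) / 2) : ℝ)) : ℂ) ?_ ?_
  · refine ⟨this.1, ?_⟩
    rw [this.2]
    push_cast
    field_simp
  · rcases hc.eq_or_lt with h | h
    · subst h
      right; right
      have : p = 0 := by nlinarith
      subst this
      have : ((-((0 + d) / 2) + 0) / ((d - 0) / 2) : ℝ) = -1 := by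
        have : d ≠ 0 := hcd.ne'
        field_simp
        ring_nf
      rw [this]; simp
    · left
      rw [Complex.norm_real, Real.norm_eq_abs, abs_lt, lt_div_iff₀ hr, div_lt_iff₀ hr]
      constructor <;> nlinarith
  · push_cast
    field_simp
    linear_combination 4 * hpp'

lemma fb_S1 (c d p : ℝ) (hc : d ≤ 1) (hcd : c < d) (hp : 0 ≤ p) (hpp : p ^ 2 = (1 - c) * (1 - d)) :
    IntegrableOn (fun t : ℝ => (Real.sqrt (-((t - d) * (t - c))) : ℂ) * (1 - (t : ℂ))⁻¹) (Set.Ioo c d) ∧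
    ∫ t in Set.Ioo c d, (Real.sqrt (-((t - d) * (t - c))) : ℂ) * (1 - (t : ℂ))⁻¹
      = π * (1 - ((c + d) / 2) - p : ℝ) := by
  have hr : 0 < (d - c) / 2 := by linarith
  have hdc : (d : ℂ) - c ≠ 0 := by
    rw [← Complex.ofReal_sub]; exact_mod_cast (by linarith : (0:ℝ) < d - c).ne'
  have hpp' : (p : ℂ) ^ 2 = (1 - c) * (1 - d) := by exact_mod_cast hpp
  have := fb_S c d hcd 1 (((1 - ((c + d) / 2) - p) / ((d - c) / 2) : ℝ) : ℂ) ?_ ?_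
  · refine ⟨this.1, ?_⟩
    rw [this.2]
    push_cast
    field_simp
  · rcases hc.eq_or_lt with h | h
    · subst h
      right; left
      have : p = 0 := by nlinarith
      subst this
      have : ((1 - ((c + 1) / 2) - 0) / ((1 - c) / 2) : ℝ) = 1 := by
        have : 1 - c ≠ 0 := by linarith
        field_simp; ring
      rw [this]; simp
    · left
      rw [Complex.norm_real, Real.norm_eq_abs, abs_lt, lt_div_iff₀ hr, div_lt_iff₀ hr]
      constructor <;> nlinarith
  · push_cast
    field_simp
    linear_combination 4 * hpp'

lemma fb_u_norm (w s : ℂ) (hs : s ^ 2 = 1 - w ^ 2) (hw : 0 < w.im) (hsr : 0 < s.re) :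
    ‖w - Complex.I * s‖ < 1 := by
  have him := congrArg Complex.im hs
  simp [pow_two] at him
  have h1 : (w - Complex.I * s) * (w + Complex.I * s) = 1 := by
    linear_combination hs - s ^ 2 * Complex.I_sq
  have h2 : ‖w - Complex.I * s‖ * ‖w + Complex.I * s‖ = 1 := by rw [← norm_mul, h1, norm_one]
  have h3 : ‖w - Complex.I * s‖ ^ 2 < ‖w + Complex.I * s‖ ^ 2 := by
    rw [← Complex.normSq_eq_norm_sq, ← Complex.normSq_eq_norm_sq, Complex.normSq_apply, Complex.normSq_apply]
    simp
    have e : s.re * s.im = - (w.re * w.im) := by linarith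
    have : 0 < w.im * s.re - w.re * s.im := by
      have : 0 < s.re * (w.im * s.re - w.re * s.im) := by
        have : s.re * (w.im * s.re - w.re * s.im) = w.im * (s.re ^ 2 + w.re ^ 2) := by
          linear_combination -w.re * e
        rw [this]; positivity
      exact pos_of_mul_pos_right this hsr.le
    nlinarith
  have h4 : ‖w - Complex.I * s‖ < ‖w + Complex.I * s‖ := lt_of_pow_lt_pow_left₀ 2 (norm_nonneg _) h3
  nlinarith [norm_nonneg (w - Complex.I * s)]

lemma fb_G (a b : ℝ) (ha : 0 < a) (hb : 0 < b) (hab : 1 < a + b) (hcd : kappaM a b < kappaP a b)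
    (z u : ℂ) (hzi : 0 < z.im) (hu : ‖u‖ < 1)
    (hz : ((kappaP a b - kappaM a b) / 2 : ℂ) * (u ^ 2 + 1) = 2 * u * (z - (kappaM a b + kappaP a b) / 2)) :
    ∫ t : ℝ, (z - (t : ℂ))⁻¹ ∂(fbeta a b) =
      (a + b) / 2 * (-(1 / z) * (-((kappaM a b + kappaP a b) / 2) + |a - 1| / (a + b) : ℝ)
        + (1 / (z - 1)) * (1 - ((kappaM a b + kappaP a b) / 2) - |b - 1| / (a + b) : ℝ)
        + (1 / (z * (1 - z))) * (((kappaP a b - kappaM a b) / 2) * u))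
      + (max (1 - a) 0 : ℝ) / z + (max (1 - b) 0 : ℝ) / (z - 1) := by
  obtain ⟨hc0, hd1, hp, hq⟩ := fb_params a b ha hb hab
  have hn : 0 < a + b := by linarith
  obtain ⟨i0, I0⟩ := fb_S0 _ _ _ hc0 hcd (by positivity) hp
  obtain ⟨i1, I1⟩ := fb_S1 _ _ _ hd1 hcd (by positivity) hq
  obtain ⟨i2, I2⟩ := fb_S _ _ hcd z u (Or.inl hu) hz
  have hzr : ∀ t : ℝ, z - t ≠ 0 := by
    intro t h
    have := congrArg Complex.im h
    simp at this
    exact hzi.ne' this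
  have hz0 : z ≠ 0 := by simpa using hzr 0
  have hz1 : z - 1 ≠ 0 := by simpa using hzr 1
  have hz1' : 1 - z ≠ 0 := by intro h; apply hz1; linear_combination -h
  have hmeas : Measurable (fun x => ENNReal.ofReal (fbDensity a b x)) := by
    apply Measurable.ennreal_ofReal
    unfold fbDensity
    exact Measurable.indicator (by fun_prop) measurableSet_Icc
  set K : ℝ → ℂ := fun t =>
    ((a + b) / (2 * π)) * (-(1 / z) * ((Real.sqrt (-((t - kappaP a b) * (t - kappaM a b))) : ℂ) * (0 - (t : ℂ))⁻¹)
      + (1 / (z - 1)) * ((Real.sqrt (-((t - kappaP a b) * (t - kappaM a b))) : ℂ) * (1 - (t : ℂ))⁻¹)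
      + (1 / (z * (1 - z))) * ((Real.sqrt (-((t - kappaP a b) * (t - kappaM a b))) : ℂ) * (z - (t : ℂ))⁻¹)) with hK
  have hpi : (π : ℂ) ≠ 0 := by exact_mod_cast pi_ne_zero
  have hfun : (fun t : ℝ => (ENNReal.ofReal (fbDensity a b t)).toReal • (z - (t : ℂ))⁻¹)
      = (Set.Ioo (kappaM a b) (kappaP a b)).indicator K := by
    funext t
    by_cases ht : t ∈ Set.Ioo (kappaM a b) (kappaP a b)
    · rw [Set.indicator_of_mem ht]
      have ht' : t ∈ Set.Icc (kappaM a b) (kappaP a b) := Set.Ioo_subset_Icc_self ht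
      unfold fbDensity
      rw [Set.indicator_of_mem ht']
      have t0 : 0 < t := lt_of_le_of_lt hc0 ht.1
      have t1 : 0 < 1 - t := by linarith [ht.2]
      rw [ENNReal.toReal_ofReal (by positivity), Complex.real_smul, hK]
      simp only []
      have t0' : (t : ℂ) ≠ 0 := by exact_mod_cast t0.ne'
      have t1' : 1 - (t : ℂ) ≠ 0 := by exact_mod_cast t1.ne'
      have t2 := hzr t
      push_cast
      rw [zero_sub]
      generalize ((Real.sqrt (-((t - kappaP a b) * (t - kappaM a b))) : ℝ) : ℂ) = R
      field_simp
      ring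
    · rw [Set.indicator_of_notMem ht]
      have : fbDensity a b t = 0 := by
        unfold fbDensity
        by_cases ht' : t ∈ Set.Icc (kappaM a b) (kappaP a b)
        · rw [Set.indicator_of_mem ht']
          have : t = kappaM a b ∨ t = kappaP a b := by
            by_contra! h
            exact ht ⟨lt_of_le_of_ne ht'.1 h.1.symm, lt_of_le_of_ne ht'.2 h.2⟩
          have : (t - kappaP a b) * (t - kappaM a b) = 0 := by
            rcases this with h | h <;> rw [h] <;> ring
          simp [this]
        · rw [Set.indicator_of_notMem ht']
      simp [this]
  have hKi : IntegrableOn K (Set.Ioo (kappaM a b) (kappaP a b)) :=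
    (((i0.const_mul _).add (i1.const_mul _)).add (i2.const_mul _)).const_mul _
  have hKI : ∫ t in Set.Ioo (kappaM a b) (kappaP a b), K t = (a + b) / 2 * (-(1 / z) * (-((kappaM a b + kappaP a b) / 2) + |a - 1| / (a + b) : ℝ)
        + (1 / (z - 1)) * (1 - ((kappaM a b + kappaP a b) / 2) - |b - 1| / (a + b) : ℝ)
        + (1 / (z * (1 - z))) * (((kappaP a b - kappaM a b) / 2) * u)) := by
    rw [hK, integral_const_mul, integral_add, integral_add, integral_const_mul, integral_const_mul, integral_const_mul, I0, I1, I2]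
    · field_simp
    · exact i0.const_mul _
    · exact i1.const_mul _
    · exact (i0.const_mul _).add (i1.const_mul _)
    · exact i2.const_mul _
  have hi1 : Integrable (fun t : ℝ => (z - (t : ℂ))⁻¹) (volume.withDensity (fun x => ENNReal.ofReal (fbDensity a b x))) := by
    rw [integrable_withDensity_iff_integrable_smul' hmeas (by simp), hfun,
      integrable_indicator_iff measurableSet_Ioo]
    exact hKi
  have hid : ∀ (y e : ℝ), Integrable (fun t : ℝ => (z - (t : ℂ))⁻¹) (ENNReal.ofReal e • Measure.dirac y) := by
    intro y e
    apply Integrable.smul_measure _ ENNReal.ofReal_ne_top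
    exact integrable_dirac (by simp)
  unfold fbeta
  rw [integral_add_measure (hi1.add_measure (hid _ _)) (hid _ _), integral_add_measure hi1 (hid _ _),
    integral_withDensity_eq_integral_toReal_smul hmeas (by simp), hfun,
    integral_indicator measurableSet_Ioo, hKI, integral_smul_measure, integral_smul_measure,
    integral_dirac, integral_dirac, ENNReal.toReal_ofReal (le_max_right _ _),
    ENNReal.toReal_ofReal (le_max_right _ _), Complex.real_smul, Complex.real_smul]
  simp [div_eq_mul_inv]

theorem free_score_fbeta (a b x : ℝ) (ha : 0 < a) (hb : 0 < b) (hab : 1 < a + b)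
    (hx : x ∈ Set.Ioo (kappaM a b) (kappaP a b)) :
    Tendsto
      (fun ε : ℝ => 2 * (∫ t : ℝ, ((x : ℂ) + ε * Complex.I - (t : ℂ))⁻¹ ∂(fbeta a b)).re)
      (nhdsWithin 0 (Set.Ioi 0))
      (nhds (((a + b - 2) * x + (1 - a)) / (x * (1 - x)))) := by
  obtain ⟨hc0, hd1, hp, hq⟩ := fb_params a b ha hb hab
  have hG := fb_G a b ha hb hab (hx.1.trans hx.2)
  have hn : 0 < a + b := by linarith
  obtain ⟨hx1, hx2⟩ := hx
  set c := kappaM a b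
  set d := kappaP a b
  have x0 : 0 < x := by linarith
  have x1 : 0 < 1 - x := by linarith
  set r : ℝ := (d - c) / 2 with hr
  set m : ℝ := (c + d) / 2 with hm
  have hr0 : 0 < r := by rw [hr]; linarith
  have hrc : (r : ℂ) ≠ 0 := by exact_mod_cast hr0.ne'
  have hrr : ((d : ℂ) - c) / 2 = r := by rw [hr]; push_cast; rfl
  have hmm : ((c : ℂ) + d) / 2 = m := by rw [hm]; push_cast; rfl
  simp only [hrr, hmm] at hG
  let Z : ℝ → ℂ := fun ε => (x : ℂ) + ε * Complex.I
  let W : ℝ → ℂ := fun ε => (Z ε - m) / r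
  let S : ℝ → ℂ := fun ε => (1 - W ε ^ 2) ^ (2⁻¹ : ℂ)
  have hD : 0 < 1 - ((x - m) / r) ^ 2 := by
    have : 1 - ((x - m) / r) ^ 2 = (r ^ 2 - (x - m) ^ 2) / r ^ 2 := by field_simp
    rw [this]
    apply div_pos _ (by positivity)
    rw [hr, hm]
    nlinarith [mul_pos (sub_pos.2 hx1) (sub_pos.2 hx2)]
  set σ : ℝ := (1 - ((x - m) / r) ^ 2) ^ (2⁻¹ : ℝ) with hσ
  have hσ0 : 0 < σ := Real.rpow_pos_of_pos hD _
  have hZ : Tendsto Z (nhdsWithin 0 (Set.Ioi 0)) (nhds (x : ℂ)) := by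
    have : Continuous Z := by fun_prop
    have := this.tendsto 0
    simp [Z] at this
    exact this.mono_left nhdsWithin_le_nhds
  have hS : Tendsto S (nhdsWithin 0 (Set.Ioi 0)) (nhds (σ : ℂ)) := by
    have h1 : Tendsto (fun ε => 1 - W ε ^ 2) (nhdsWithin 0 (Set.Ioi 0))
        (nhds (((1 - ((x - m) / r) ^ 2 : ℝ)) : ℂ)) := by
      have := (((hZ.sub_const (m : ℂ)).div_const (r : ℂ)).pow 2).const_sub 1
      push_cast
      exact this
    have h2 := (continuousAt_cpow_const (b := (2⁻¹ : ℂ)) (a := (((1 - ((x - m) / r) ^ 2 : ℝ)) : ℂ))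
      (Complex.ofReal_mem_slitPlane.2 hD)).tendsto.comp h1
    have h3 : (((1 - ((x - m) / r) ^ 2 : ℝ)) : ℂ) ^ (2⁻¹ : ℂ) = (σ : ℂ) := by
      rw [hσ, Complex.ofReal_cpow hD.le]
      push_cast; rfl
    rw [h3] at h2
    exact h2
  have hev : ∀ᶠ ε in nhdsWithin (0:ℝ) (Set.Ioi 0), 0 < (S ε).re := by
    have : Tendsto (fun ε => (S ε).re) (nhdsWithin 0 (Set.Ioi 0)) (nhds σ) := by
      have := (Complex.continuous_re.tendsto (σ : ℂ)).comp hS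
      exact this
    exact this.eventually (lt_mem_nhds hσ0)
  set P : ℝ := -m + |a - 1| / (a + b) with hP
  set Q : ℝ := 1 - m - |b - 1| / (a + b) with hQ
  have hlim : Tendsto (fun ε : ℝ => (a + b : ℂ) / 2 * (-(1 / Z ε) * P + (1 / (Z ε - 1)) * Q
        + (1 / (Z ε * (1 - Z ε))) * (r * (W ε - Complex.I * S ε)))
      + (max (1 - a) 0 : ℝ) / Z ε + (max (1 - b) 0 : ℝ) / (Z ε - 1)) (nhdsWithin 0 (Set.Ioi 0))
      (nhds ((a + b : ℂ) / 2 * (-(1 / x) * P + (1 / (x - 1)) * Q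
        + (1 / (x * (1 - x))) * (r * ((x - m) / r - Complex.I * σ)))
      + (max (1 - a) 0 : ℝ) / x + (max (1 - b) 0 : ℝ) / (x - 1))) := by
    have x0' : (x : ℂ) ≠ 0 := by exact_mod_cast x0.ne'
    have x1' : 1 - (x : ℂ) ≠ 0 := by exact_mod_cast x1.ne'
    have x2' : (x : ℂ) - 1 ≠ 0 := by intro h; apply x1'; linear_combination -h
    have hW : Tendsto W (nhdsWithin 0 (Set.Ioi 0)) (nhds ((x - m : ℂ) / r)) :=
      (hZ.sub_const (m : ℂ)).div_const (r : ℂ)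
    have hZ1 := hZ.sub_const (1 : ℂ)
    have hZ2 := hZ.const_sub (1 : ℂ)
    refine ((Tendsto.const_mul _ (((Tendsto.mul_const _ ?_).add (Tendsto.mul_const _ ?_)).add
      (Tendsto.mul ?_ (Tendsto.const_mul _ ?_)))).add ?_).add ?_
    · exact (tendsto_const_nhds.div hZ x0').neg
    · exact tendsto_const_nhds.div hZ1 x2'
    · exact tendsto_const_nhds.div (hZ.mul hZ2) (mul_ne_zero x0' x1')
    · exact hW.sub (hS.const_mul _)
    · exact tendsto_const_nhds.div hZ x0'
    · exact tendsto_const_nhds.div hZ1 x2'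
  have hlim2 := ((Complex.continuous_re.tendsto _).comp hlim).const_mul 2
  have hval : 2 * ((a + b : ℂ) / 2 * (-(1 / x) * P + (1 / (x - 1)) * Q
        + (1 / (x * (1 - x))) * (r * ((x - m) / r - Complex.I * σ)))
      + (max (1 - a) 0 : ℝ) / x + (max (1 - b) 0 : ℝ) / (x - 1)).re
      = ((a + b - 2) * x + (1 - a)) / (x * (1 - x)) := by
    have e : ((a + b : ℂ) / 2 * (-(1 / x) * P + (1 / (x - 1)) * Q
        + (1 / (x * (1 - x))) * (r * ((x - m) / r - Complex.I * σ)))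
      + (max (1 - a) 0 : ℝ) / x + (max (1 - b) 0 : ℝ) / (x - 1)) =
      (((a + b) / 2 * (-(1 / x) * P + (1 / (x - 1)) * Q + (1 / (x * (1 - x))) * (x - m))
        + max (1 - a) 0 / x + max (1 - b) 0 / (x - 1) : ℝ) : ℂ)
      + ((-((a + b) / 2 * (1 / (x * (1 - x))) * r * σ) : ℝ) : ℂ) * Complex.I := by
      rw [mul_sub (r : ℂ), mul_div_cancel₀ _ hrc]
      push_cast
      ring
    rw [e]
    rw [Complex.add_re, Complex.re_ofReal_mul, Complex.I_re, mul_zero, add_zero, Complex.ofReal_re]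
    have ma : max (1 - a) 0 = (|a - 1| + (1 - a)) / 2 := by
      rcases le_total a 1 with h | h
      · rw [max_eq_left (by linarith), abs_of_nonpos (by linarith)]; ring
      · rw [max_eq_right (by linarith), abs_of_nonneg (by linarith)]; ring
    have mb : max (1 - b) 0 = (|b - 1| + (1 - b)) / 2 := by
      rcases le_total b 1 with h | h
      · rw [max_eq_left (by linarith), abs_of_nonpos (by linarith)]; ring
      · rw [max_eq_right (by linarith), abs_of_nonneg (by linarith)]; ring
    rw [ma, mb, hP, hQ, show x - 1 = -(1 - x) by ring]
    generalize |a - 1| = A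
    generalize |b - 1| = B
    generalize m = M
    have x1n := x1.ne'
    field_simp
    ring
  rw [hval] at hlim2
  refine hlim2.congr' ?_
  filter_upwards [hev, self_mem_nhdsWithin] with ε hε hε0
  have hε0' : 0 < ε := hε0
  have hS2 : S ε ^ 2 = 1 - W ε ^ 2 := Complex.cpow_ofNat_inv_pow _ _
  have hWi : 0 < (W ε).im := by
    have : (W ε).im = ε / r := by
      simp only [W, Z]
      rw [Complex.div_ofReal_im]
      simp
    rw [this]; positivity
  have hu := fb_u_norm (W ε) (S ε) hS2 hWi hε
  have hrW : r * W ε = Z ε - m := by simp only [W]; field_simp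
  have := hG (Z ε) (W ε - Complex.I * S ε) (by simp [Z, hε0']) hu (by
    linear_combination (-r * S ε ^ 2) * Complex.I_sq * (-1) + r * hS2 * (-1) + 2 * (W ε - Complex.I * S ε) * hrW)
  simp only [Function.comp]
  congr 2
  exact this.symm
end

section
/- Let ℓ be the unilateral shift on the Hilbert space ℓ²(ℕ) (so ℓ eₙ = eₙ₊₁ for the standard orthonormal basis (eₙ)ₙ≥₀) and let ℓ* be its adjoint. For real numbers α, β, γ, let X = γ·I + β·ℓ + ℓ* + (1+α)·ℓℓ* + α·ℓ²ℓ*. Then for every n ≥ 0, ⟨Xⁿ e₀, e₀⟩ = Σ_{π ∈ NCL(n)} α^{dc(π)} β^{sc(π)} γ^{sg(π)} (the n = 0 term being 1). -/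
/-- `π` is a non-crossing linked partition of `{0, 1, …, n-1}` (identified with `[n] = {1,…,n}`):
a collection of nonempty blocks covering `Fin n`, any two distinct blocks being
non-crossing and nearly disjoint. -/
def IsNCL (n : ℕ) (π : Finset (Finset (Fin n))) : Prop :=
  (∀ B ∈ π, B.Nonempty) ∧
  (∀ i : Fin n, ∃ B ∈ π, i ∈ B) ∧
  (∀ E ∈ π, ∀ F ∈ π, E ≠ F →
    -- non-crossing
    (¬ ∃ b₁ b₂ c₁ c₂ : Fin n, b₁ ∈ E ∧ b₂ ∈ E ∧ c₁ ∈ F ∧ c₂ ∈ F ∧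
        b₁ < c₁ ∧ c₁ < b₂ ∧ b₂ < c₂) ∧
    -- nearly disjoint
    (∀ i ∈ E ∩ F,
      ((∀ j ∈ E, i ≤ j) ∧ 1 < E.card ∧ ¬ (∀ j ∈ F, i ≤ j)) ∨
      (¬ (∀ j ∈ E, i ≤ j) ∧ (∀ j ∈ F, i ≤ j) ∧ 1 < F.card)))

/-- The set of all non-crossing linked partitions of `[n]`. -/
noncomputable def NCL (n : ℕ) : Finset (Finset (Finset (Fin n))) :=
  @Finset.filter _ (IsNCL n) (Classical.decPred _) Finset.univ

/-- `dc π`: the number of doubly covered elements. -/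
def dc {n : ℕ} (π : Finset (Finset (Fin n))) : ℕ :=
  (Finset.univ.filter fun i : Fin n => (π.filter fun B => i ∈ B).card = 2).card

/-- `sc π`: the number of singly covered elements that are the minimum of a block
of size at least 2. -/
def sc {n : ℕ} (π : Finset (Finset (Fin n))) : ℕ :=
  (Finset.univ.filter fun i : Fin n =>
    (π.filter fun B => i ∈ B).card = 1 ∧
    ∃ B ∈ π, i ∈ B ∧ (∀ j ∈ B, i ≤ j) ∧ 2 ≤ B.card).card

/-- `sg π`: the number of singleton blocks. -/
def sg {n : ℕ} (π : Finset (Finset (Fin n))) : ℕ :=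
  (π.filter fun B => B.card = 1).card

open scoped InnerProductSpace


namespace NCLAux

/-- Parent maps of non-crossing forests on `{0,…,n-1}`. -/
def Good (n : ℕ) (p : ℕ → ℕ) : Prop :=
  (∀ j, p j ≤ j) ∧ (∀ j, n ≤ j → p j = j) ∧ (∀ c d, p c < p d → p d < c → c < d → False)

def Used (n : ℕ) (p : ℕ → ℕ) (i : ℕ) : Prop := ∃ c, c < n ∧ c ≠ i ∧ p c = i

def Vis (n : ℕ) (p : ℕ → ℕ) (i : ℕ) : Prop := ∀ c, c < n → p c < i → i < c → False

open Classical in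
noncomputable def cB (α β : ℂ) (p : ℕ → ℕ) (i : ℕ) : ℂ := if p i = i then β else α

open Classical in
noncomputable def cA (α β γ : ℂ) (n : ℕ) (p : ℕ → ℕ) (i : ℕ) : ℂ :=
  if Used n p i then cB α β p i else if p i = i then γ else 1

open Classical in
noncomputable def cX (n : ℕ) (p : ℕ → ℕ) (i : ℕ) : Polynomial ℂ :=
  if Vis n p i then Polynomial.X else 0

noncomputable def W (α β γ : ℂ) (n : ℕ) (p : ℕ → ℕ) : Polynomial ℂ :=
  ∏ i ∈ Finset.range n,
    (Polynomial.C (cA α β γ n p i) + Polynomial.C (cB α β p i) * cX n p i)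

noncomputable def W0 (α β γ : ℂ) (n : ℕ) (p : ℕ → ℕ) : ℂ :=
  ∏ i ∈ Finset.range n, cA α β γ n p i

open Classical in
noncomputable def S : ℕ → Finset (ℕ → ℕ)
  | 0 => {id}
  | n + 1 => (S n).biUnion fun p =>
      ((Finset.range (n+1)).filter (Vis n p)).image fun a => Function.update p n a

lemma cA_used {α β γ : ℂ} {n : ℕ} {p : ℕ → ℕ} {i : ℕ} (h : Used n p i) :
    cA α β γ n p i = cB α β p i := by
  simp [cA, h]

lemma cA_congr {α β γ : ℂ} {m n : ℕ} {q p : ℕ → ℕ} {i : ℕ} (h : Used m q i ↔ Used n p i)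
    (hq : q i = p i) : cA α β γ m q i = cA α β γ n p i := by
  by_cases hu : Used n p i
  · simp [cA, hu, h.2 hu, cB, hq]
  · simp [cA, hu, mt h.1 hu, hq]

lemma cX_pos {n : ℕ} {p : ℕ → ℕ} {i : ℕ} (h : Vis n p i) : cX n p i = Polynomial.X := by
  simp [cX, h]

lemma cX_neg {n : ℕ} {p : ℕ → ℕ} {i : ℕ} (h : ¬ Vis n p i) : cX n p i = 0 := by
  simp [cX, h]

lemma cX_congr {m n : ℕ} {q p : ℕ → ℕ} {i : ℕ} (h : Vis m q i ↔ Vis n p i) :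
    cX m q i = cX n p i := by
  by_cases hu : Vis n p i
  · rw [cX_pos hu, cX_pos (h.2 hu)]
  · rw [cX_neg hu, cX_neg (mt h.1 hu)]

lemma mem_S (n : ℕ) (p : ℕ → ℕ) : p ∈ S n ↔ Good n p := by
  classical
  induction n generalizing p with
  | zero =>
    simp only [S, Finset.mem_singleton, Good]
    constructor
    · rintro rfl
      refine ⟨fun j => le_rfl, fun j _ => rfl, ?_⟩
      simp only [id]; intros; omega
    · rintro ⟨_, h, _⟩
      funext j; exact h j (Nat.zero_le _)
  | succ n ih =>
    simp only [S, Finset.mem_biUnion, Finset.mem_image, Finset.mem_filter, Finset.mem_range]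
    constructor
    · rintro ⟨q, hq, a, ⟨ha, hv⟩, rfl⟩
      obtain ⟨h1, h2, h3⟩ := (ih q).1 hq
      refine ⟨?_, ?_, ?_⟩
      · intro j
        by_cases hj : j = n
        · subst hj; simp; omega
        · simp [Function.update_of_ne hj, h1]
      · intro j hj
        rw [Function.update_of_ne (by omega)]; exact h2 j (by omega)
      · intro c d hcd hdc hlt
        by_cases hd : d = n
        · subst hd
          rw [Function.update_of_ne (by omega : c ≠ d)] at hcd
          simp only [Function.update_self] at hcd hdc
          exact hv c hlt hcd hdc
        · rw [Function.update_of_ne hd] at hcd hdc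
          by_cases hc : c = n
          · subst hc
            have := h2 d (by omega)
            omega
          · rw [Function.update_of_ne hc] at hcd
            exact h3 c d hcd hdc hlt
    · rintro ⟨h1, h2, h3⟩
      refine ⟨Function.update p n n, (ih _).2 ⟨?_, ?_, ?_⟩, p n, ⟨?_, ?_⟩, ?_⟩
      · intro j
        by_cases hj : j = n
        · subst hj; simp
        · simp [Function.update_of_ne hj, h1]
      · intro j hj
        by_cases hj' : j = n
        · subst hj'; simp
        · rw [Function.update_of_ne hj']; exact h2 j (by omega)
      · intro c d hcd hdc hlt
        by_cases hd : d = n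
        · subst hd; simp at hdc; omega
        · rw [Function.update_of_ne hd] at hcd hdc
          by_cases hc : c = n
          · subst hc
            simp at hcd; omega
          · rw [Function.update_of_ne hc] at hcd
            exact h3 c d hcd hdc hlt
      · have := h1 n; omega
      · intro c hc h4 h5
        rw [Function.update_of_ne (by omega)] at h4
        exact h3 c n h4 h5 hc
      · simp

open Classical in
lemma sum_S {M : Type*} [AddCommMonoid M] (n : ℕ) (f : (ℕ → ℕ) → M) :
    ∑ p ∈ S (n+1), f p =
      ∑ p ∈ S n, ∑ a ∈ (Finset.range (n+1)).filter (Vis n p), f (Function.update p n a) := by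
  rw [S, Finset.sum_biUnion]
  · refine Finset.sum_congr rfl fun p hp => ?_
    rw [Finset.sum_image]
    intro a _ b _ hab
    have := congrFun hab n
    simpa using this
  · intro p hp q hq hpq
    rw [Function.onFun, Finset.disjoint_left]
    intro r hr hr'
    simp only [Finset.mem_image] at hr hr'
    obtain ⟨a, -, rfl⟩ := hr
    obtain ⟨b, -, hb⟩ := hr'
    apply hpq
    have hp2 := ((mem_S n p).1 hp).2.1 n le_rfl
    have hq2 := ((mem_S n q).1 hq).2.1 n le_rfl
    funext j
    by_cases hj : j = n
    · subst hj; rw [hp2, hq2]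
    · have := congrFun hb j
      simpa [Function.update_of_ne hj] using this.symm

lemma W_self (α β γ : ℂ) (n : ℕ) (p : ℕ → ℕ) (hp : Good n p) :
    W α β γ (n+1) (Function.update p n n) =
      W α β γ n p * (Polynomial.C γ + Polynomial.C β * Polynomial.X) := by
  obtain ⟨h1, h2, h3⟩ := hp
  have : Function.update p n n = p := by
    conv_lhs => rw [← h2 n le_rfl]
    simp [h2 n le_rfl]
  rw [this, W, Finset.prod_range_succ, W]
  have hn := h2 n le_rfl
  congr 1
  · refine Finset.prod_congr rfl fun i hi => ?_
    rw [Finset.mem_range] at hi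
    have hu : Used (n+1) p i ↔ Used n p i := by
      constructor
      · rintro ⟨c, hc, h4, h5⟩
        refine ⟨c, ?_, h4, h5⟩
        rcases Nat.lt_succ_iff_lt_or_eq.1 hc with h | rfl
        · exact h
        · omega
      · rintro ⟨c, hc, h4, h5⟩
        exact ⟨c, by omega, h4, h5⟩
    have hv : Vis (n+1) p i ↔ Vis n p i := by
      constructor
      · intro h c hc
        exact h c (by omega)
      · intro h c hc h4 h5
        rcases Nat.lt_succ_iff_lt_or_eq.1 hc with h' | rfl
        · exact h c h' h4 h5
        · omega
    rw [cA_congr hu rfl, cX_congr hv]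
  · have hu : ¬ Used (n+1) p n := by
      rintro ⟨c, hc, h4, h5⟩
      have := h1 c
      omega
    have hv : Vis (n+1) p n := by
      intro c hc h4 h5; omega
    simp [cA, cX, cB, hu, hv, hn]

lemma W_arc (α β γ : ℂ) (n : ℕ) (p : ℕ → ℕ) (hp : Good n p) (a : ℕ) (ha : a < n)
    (hva : Vis n p a) :
    W α β γ (n+1) (Function.update p n a) =
      (Polynomial.C (cB α β p a) *
       (∏ i ∈ (Finset.range n).filter (· < a),
        (Polynomial.C (cA α β γ n p i) + Polynomial.C (cB α β p i) * cX n p i)) *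
       (∏ i ∈ (Finset.range n).filter (fun i => a < i), Polynomial.C (cA α β γ n p i))) *
      ((1 + Polynomial.X) * (1 + Polynomial.C α * Polynomial.X)) := by
  obtain ⟨h1, h2, h3⟩ := hp
  set q := Function.update p n a with hq
  have hqn : q n = a := by simp [hq]
  have hqi : ∀ i, i ≠ n → q i = p i := fun i hi => by rw [hq, Function.update_of_ne hi]
  have hu : ∀ i, i < n → (Used (n+1) q i ↔ (Used n p i ∨ i = a)) := by
    intro i hi
    constructor
    · rintro ⟨c, hc, h4, h5⟩
      rcases Nat.lt_succ_iff_lt_or_eq.1 hc with h | rfl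
      · left; exact ⟨c, h, h4, by rw [← hqi c (by omega)]; exact h5⟩
      · right; omega
    · rintro (⟨c, hc, h4, h5⟩ | rfl)
      · exact ⟨c, by omega, h4, by rw [hqi c (by omega)]; exact h5⟩
      · exact ⟨n, by omega, by omega, hqn⟩
  have hv : ∀ i, i < n → (Vis (n+1) q i ↔ (Vis n p i ∧ ¬ a < i)) := by
    intro i hi
    constructor
    · intro h
      refine ⟨fun c hc h4 h5 => h c (by omega) (by rw [hqi c (by omega)]; exact h4) h5, ?_⟩
      intro hai
      exact h n (by omega) (by omega) hi
    · rintro ⟨h, h'⟩ c hc h4 h5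
      rcases Nat.lt_succ_iff_lt_or_eq.1 hc with h6 | rfl
      · rw [hqi c (by omega)] at h4
        exact h c h6 h4 h5
      · omega
  have hB : ∀ i, i < n → cB α β q i = cB α β p i := by
    intro i hi; simp [cB, hqi i (by omega)]
  rw [W, Finset.prod_range_succ]
  have hlast : (Polynomial.C (cA α β γ (n+1) q n) + Polynomial.C (cB α β q n) * cX (n+1) q n)
      = 1 + Polynomial.C α * Polynomial.X := by
    have hu : ¬ Used (n+1) q n := by
      rintro ⟨c, hc, h4, h5⟩
      have := h1 c
      rw [hqi c h4] at h5
      omega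
    have hv : Vis (n+1) q n := by
      intro c hc h4 h5; omega
    have : q n ≠ n := by omega
    simp [cA, cX, cB, hu, hv, this]
  rw [hlast]
  have hsplit : Finset.range n = insert a ((Finset.range n).filter (· < a) ∪
      (Finset.range n).filter (fun i => a < i)) := by
    ext i; simp; omega
  rw [hsplit, Finset.prod_insert (by simp), Finset.prod_union, ← hsplit]
  · have e1 : (Polynomial.C (cA α β γ (n+1) q a) + Polynomial.C (cB α β q a) * cX (n+1) q a)
        = Polynomial.C (cB α β p a) * (1 + Polynomial.X) := by
      rw [cA_used ((hu a ha).2 (Or.inr rfl)), cX_pos ((hv a ha).2 ⟨hva, lt_irrefl a⟩), hB a ha]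
      ring
    have e2 : ∏ i ∈ (Finset.range n).filter (· < a),
          (Polynomial.C (cA α β γ (n+1) q i) + Polynomial.C (cB α β q i) * cX (n+1) q i)
        = ∏ i ∈ (Finset.range n).filter (· < a),
        (Polynomial.C (cA α β γ n p i) + Polynomial.C (cB α β p i) * cX n p i) := by
      refine Finset.prod_congr rfl fun i hi => ?_
      simp only [Finset.mem_filter, Finset.mem_range] at hi
      have h5 : ¬ a < i := by omega
      have h6 : i ≠ a := by omega
      rw [cA_congr (n := n) ((hu i hi.1).trans (by simp [h6])) (hqi i (by omega)),
        hB i hi.1, cX_congr (n := n) (p := p) ((hv i hi.1).trans (by simp [h5]))]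
    have e3 : ∏ i ∈ (Finset.range n).filter (fun i => a < i),
          (Polynomial.C (cA α β γ (n+1) q i) + Polynomial.C (cB α β q i) * cX (n+1) q i)
        = ∏ i ∈ (Finset.range n).filter (fun i => a < i), Polynomial.C (cA α β γ n p i) := by
      refine Finset.prod_congr rfl fun i hi => ?_
      simp only [Finset.mem_filter, Finset.mem_range] at hi
      have h5 : a < i := by omega
      have h6 : i ≠ a := by omega
      rw [cA_congr (n := n) ((hu i hi.1).trans (by simp [h6])) (hqi i (by omega)),
        cX_neg (by rw [hv i hi.1]; tauto)]
      simp
    rw [e1, e2, e3]; ring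
  · rw [Finset.disjoint_left]; intro i; simp; omega

noncomputable def P (α β γ : ℂ) (n : ℕ) : Polynomial ℂ := ∑ p ∈ S n, W α β γ n p

lemma W_coeff (α β γ : ℂ) (n : ℕ) (p : ℕ → ℕ) :
    (W α β γ n p).coeff 0 = W0 α β γ n p := by
  rw [Polynomial.coeff_zero_eq_eval_zero, W, Polynomial.eval_prod, W0]
  refine Finset.prod_congr rfl fun i _ => ?_
  have : (cX n p i).eval 0 = 0 := by
    unfold cX; split_ifs <;> simp
  simp [this]

open Classical in
lemma W_tele (α β γ : ℂ) (n : ℕ) (p : ℕ → ℕ) :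
    ∑ a ∈ (Finset.range n).filter (Vis n p), (Polynomial.C (cB α β p a) *
       (∏ i ∈ (Finset.range n).filter (· < a),
        (Polynomial.C (cA α β γ n p i) + Polynomial.C (cB α β p i) * cX n p i)) *
       (∏ i ∈ (Finset.range n).filter (fun i => a < i), Polynomial.C (cA α β γ n p i)))
      = (W α β γ n p).divX := by
  have h := Finset.prod_add_ordered (Finset.range n)
    (fun i => Polynomial.C (cA α β γ n p i)) (fun i => Polynomial.C (cB α β p i) * cX n p i)
  have h2 := Polynomial.divX_mul_X_add (W α β γ n p)
  have h0 : ∏ i ∈ Finset.range n, Polynomial.C (cA α β γ n p i)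
      = Polynomial.C ((W α β γ n p).coeff 0) := by
    rw [W_coeff, W0, map_prod]
  rw [h0] at h
  have h3 : W α β γ n p = _ := h
  have h4 := h2.trans h3
  rw [add_comm] at h4
  have h5 := add_left_cancel h4
  apply mul_right_cancel₀ (Polynomial.X_ne_zero (R := ℂ))
  rw [h5, Finset.sum_mul, Finset.sum_filter]
  refine Finset.sum_congr rfl fun a _ => ?_
  unfold cX
  split_ifs <;> ring

lemma P_succ (α β γ : ℂ) (n : ℕ) :
    P α β γ (n+1) = P α β γ n * (Polynomial.C γ + Polynomial.C β * Polynomial.X)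
      + (P α β γ n).divX * ((1 + Polynomial.X) * (1 + Polynomial.C α * Polynomial.X)) := by
  classical
  have hd : (P α β γ n).divX = ∑ p ∈ S n, (W α β γ n p).divX := by
    unfold P
    exact map_sum (⟨⟨Polynomial.divX, by simp⟩, fun a b => Polynomial.divX_add⟩ :
      Polynomial ℂ →+ Polynomial ℂ) _ _
  rw [hd]
  unfold P
  rw [sum_S, Finset.sum_mul, Finset.sum_mul, ← Finset.sum_add_distrib]
  refine Finset.sum_congr rfl fun p hp => ?_
  rw [mem_S] at hp
  have hvn : Vis n p n := by intro c hc h4 h5; omega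
  have : (Finset.range (n+1)).filter (Vis n p)
      = insert n ((Finset.range n).filter (Vis n p)) := by
    rw [Finset.range_add_one, Finset.filter_insert, if_pos hvn]
  rw [this, Finset.sum_insert (by simp), W_self _ _ _ _ _ hp, ← W_tele, Finset.sum_mul]
  congr 1
  refine Finset.sum_congr rfl fun a ha => ?_
  rw [Finset.mem_filter, Finset.mem_range] at ha
  exact W_arc _ _ _ _ _ hp _ ha.1 ha.2

noncomputable def phi {H : Type*} [AddCommGroup H] [Module ℂ H] (e : ℕ → H) :
    Polynomial ℂ →ₗ[ℂ] H :=
  (Polynomial.basisMonomials ℂ).constr ℂ e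

lemma phi_X {H : Type*} [AddCommGroup H] [Module ℂ H] (e : ℕ → H) (k : ℕ) :
    phi e (Polynomial.X ^ k) = e k := by
  have := (Polynomial.basisMonomials ℂ).constr_basis ℂ e k
  simpa [phi, Polynomial.X_pow_eq_monomial] using this

lemma op_phi {H : Type*} [AddCommGroup H] [Module ℂ H] (e : ℕ → H)
    (l lstar : Module.End ℂ H)
    (hl : ∀ k : ℕ, l (e k) = e (k + 1))
    (hls0 : lstar (e 0) = 0)
    (hls : ∀ k : ℕ, lstar (e (k + 1)) = e k) (α β γ : ℂ) (p : Polynomial ℂ) :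
    (γ • (1 : Module.End ℂ H) + β • l + lstar
        + (1 + α) • (l * lstar) + α • (l * l * lstar)) (phi e p) =
    phi e (p * (Polynomial.C γ + Polynomial.C β * Polynomial.X)
      + p.divX * ((1 + Polynomial.X) * (1 + Polynomial.C α * Polynomial.X))) := by
  induction p using Polynomial.induction_on' with
  | add p q hp hq =>
    rw [map_add, map_add, hp, hq, ← map_add]
    congr 1
    rw [Polynomial.divX_add]; ring
  | monomial k c =>
    rw [← Polynomial.C_mul_X_pow_eq_monomial, ← Polynomial.smul_eq_C_mul, map_smul, map_smul, phi_X]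
    have hs : ∀ (c : ℂ) (p q r : Polynomial ℂ), (c • p) * q + (c • p).divX * r
        = c • (p * q + p.divX * r) := by
      intro c p q r
      rw [Polynomial.smul_eq_C_mul, Polynomial.divX_C_mul, Polynomial.smul_eq_C_mul]; ring
    rw [hs, map_smul]
    congr 1
    cases k with
    | zero =>
      have : ((Polynomial.X ^ 0 : Polynomial ℂ) * (Polynomial.C γ + Polynomial.C β * Polynomial.X)
        + (Polynomial.X ^ 0 : Polynomial ℂ).divX *
          ((1 + Polynomial.X) * (1 + Polynomial.C α * Polynomial.X)))
        = γ • Polynomial.X ^ 0 + β • Polynomial.X ^ 1 := by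
        simp only [Polynomial.smul_eq_C_mul, pow_zero, Polynomial.divX_one]; ring
      rw [this]
      simp only [map_add, map_smul, phi_X]
      simp [hls0, hl]
    | succ k =>
      have hdiv : (Polynomial.X ^ (k+1) : Polynomial ℂ).divX = Polynomial.X ^ k := by
        ext j; simp [Polynomial.coeff_divX, Polynomial.coeff_X_pow]
      have : ((Polynomial.X ^ (k+1) : Polynomial ℂ) * (Polynomial.C γ + Polynomial.C β * Polynomial.X)
        + (Polynomial.X ^ (k+1) : Polynomial ℂ).divX *
          ((1 + Polynomial.X) * (1 + Polynomial.C α * Polynomial.X)))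
        = γ • Polynomial.X ^ (k+1) + β • Polynomial.X ^ (k+2) + Polynomial.X ^ k
          + (1 + α) • Polynomial.X ^ (k+1) + α • Polynomial.X ^ (k+2) := by
        rw [hdiv]
        simp only [Polynomial.smul_eq_C_mul, map_add, map_one]; ring
      rw [this]
      simp only [map_add, map_smul, phi_X]
      simp [hls, hl]

lemma phi_pow {H : Type*} [AddCommGroup H] [Module ℂ H] (e : ℕ → H)
    (l lstar : Module.End ℂ H)
    (hl : ∀ k : ℕ, l (e k) = e (k + 1))
    (hls0 : lstar (e 0) = 0)
    (hls : ∀ k : ℕ, lstar (e (k + 1)) = e k) (α β γ : ℂ) (n : ℕ) :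
    ((γ • (1 : Module.End ℂ H) + β • l + lstar
        + (1 + α) • (l * lstar) + α • (l * l * lstar)) ^ n) (e 0) = phi e (P α β γ n) := by
  induction n with
  | zero =>
    have : P α β γ 0 = Polynomial.X ^ 0 := by simp [P, S, W]
    rw [this, phi_X]; simp
  | succ n ih =>
    rw [pow_succ', Module.End.mul_apply, ih, op_phi e l lstar hl hls0 hls, P_succ]

lemma inner_phi {H : Type*} [NormedAddCommGroup H] [InnerProductSpace ℂ H]
    (e : ℕ → H) (he : Orthonormal ℂ e) (p : Polynomial ℂ) :
    ⟪phi e p, e 0⟫_ℂ = (starRingEnd ℂ) (p.coeff 0) := by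
  induction p using Polynomial.induction_on' with
  | add p q hp hq => rw [map_add, inner_add_left, hp, hq]; simp
  | monomial k c =>
    rw [← Polynomial.C_mul_X_pow_eq_monomial, ← Polynomial.smul_eq_C_mul, map_smul, phi_X,
      inner_smul_left, orthonormal_iff_ite.1 he]
    cases k <;> simp

end NCLAux
namespace NCLAux

def blk (n : ℕ) (p : ℕ → ℕ) (i : Fin n) : Finset (Fin n) :=
  Finset.univ.filter fun j : Fin n => j = i ∨ p j = i

open Classical in
noncomputable def toNCL (n : ℕ) (p : ℕ → ℕ) : Finset (Finset (Fin n)) :=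
  (Finset.univ.filter fun i : Fin n => Used n p i ∨ p i = i).image (blk n p)

lemma mem_blk {n : ℕ} {p : ℕ → ℕ} {i j : Fin n} : j ∈ blk n p i ↔ j = i ∨ p j = i := by
  simp [blk]

lemma mem_toNCL {n : ℕ} {p : ℕ → ℕ} {B : Finset (Fin n)} :
    B ∈ toNCL n p ↔ ∃ i : Fin n, (Used n p i ∨ p i = i) ∧ blk n p i = B := by
  simp [toNCL]

lemma self_mem_blk {n : ℕ} {p : ℕ → ℕ} (i : Fin n) : i ∈ blk n p i := by simp [blk]

lemma le_of_mem_blk {n : ℕ} {p : ℕ → ℕ} (hp : Good n p) {i j : Fin n} (h : j ∈ blk n p i) :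
    i ≤ j := by
  rcases mem_blk.1 h with rfl | h
  · exact le_rfl
  · have := hp.1 j
    rw [Fin.le_def]; omega

lemma blk_inj {n : ℕ} {p q : ℕ → ℕ} (hp : Good n p) (hq : Good n q) {i j : Fin n}
    (h : blk n p i = blk n q j) : i = j := by
  apply le_antisymm
  · apply le_of_mem_blk hp; rw [h]; exact self_mem_blk j
  · apply le_of_mem_blk hq; rw [← h]; exact self_mem_blk i

lemma one_lt_card_blk {n : ℕ} {p : ℕ → ℕ} {i : Fin n} :
    1 < (blk n p i).card ↔ Used n p i := by
  rw [Finset.one_lt_card]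
  constructor
  · rintro ⟨a, ha, b, hb, hab⟩
    rw [mem_blk] at ha hb
    by_cases h : a = i
    · have hbi : b ≠ i := by rintro rfl; exact hab h
      exact ⟨b, b.2, fun h' => hbi (Fin.ext h'), hb.resolve_left hbi⟩
    · exact ⟨a, a.2, fun h' => h (Fin.ext h'), ha.resolve_left h⟩
  · rintro ⟨c, hc, h1, h2⟩
    exact ⟨⟨c, hc⟩, mem_blk.2 (Or.inr h2), i, self_mem_blk i, fun h => h1 (by simp [← h])⟩

lemma used_parent {n : ℕ} {p : ℕ → ℕ} {j : Fin n} (h : p j ≠ j) : Used n p (p j) :=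
  ⟨j, j.2, fun h' => h h'.symm, rfl⟩

lemma isNCL_toNCL {n : ℕ} {p : ℕ → ℕ} (hp : Good n p) : IsNCL n (toNCL n p) := by
  refine ⟨?_, ?_, ?_⟩
  · intro B hB
    obtain ⟨i, -, rfl⟩ := mem_toNCL.1 hB
    exact ⟨i, self_mem_blk i⟩
  · intro j
    by_cases h : p j = j
    · exact ⟨blk n p j, mem_toNCL.2 ⟨j, Or.inr h, rfl⟩, self_mem_blk j⟩
    · have hlt : p j < n := lt_of_le_of_lt (hp.1 j) j.2
      exact ⟨blk n p ⟨p j, hlt⟩, mem_toNCL.2 ⟨⟨p j, hlt⟩, Or.inl (used_parent h), rfl⟩,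
        mem_blk.2 (Or.inr rfl)⟩
  · intro E hE F hF hne
    obtain ⟨e, he, rfl⟩ := mem_toNCL.1 hE
    obtain ⟨f, hf, rfl⟩ := mem_toNCL.1 hF
    have hef : e ≠ f := fun h => hne (by rw [h])
    constructor
    · rintro ⟨b₁, b₂, c₁, c₂, hb1, hb2, hc1, hc2, h1, h2, h3⟩
      have l1 := le_of_mem_blk hp hb1
      have l2 := le_of_mem_blk hp hc1
      rw [mem_blk] at hb1 hb2 hc1 hc2
      have k1 : p b₂ = e := hb2.resolve_left (by omega)
      have k2 : p c₂ = f := hc2.resolve_left (by omega)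
      rcases lt_or_gt_of_ne hef with h | h
      · exact hp.2.2 b₂ c₂ (by omega) (by omega) h3
      · have k3 : p c₁ = f := hc1.resolve_left (by omega)
        exact hp.2.2 c₁ b₂ (by omega) (by omega) h2
    · intro i hi
      rw [Finset.mem_inter] at hi
      obtain ⟨h1, h2⟩ := hi
      have l1 := le_of_mem_blk hp h1
      have l2 := le_of_mem_blk hp h2
      rw [mem_blk] at h1 h2
      rcases h1 with rfl | h1
      · left
        have h2 := h2.resolve_left hef
        have hn : p i ≠ i := fun h => hef (Fin.ext (by omega))
        refine ⟨fun j hj => le_of_mem_blk hp hj, one_lt_card_blk.2 (he.resolve_right hn), ?_⟩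
        intro h
        exact hef (le_antisymm (h f (self_mem_blk f)) l2)
      · right
        have h2 : i = f := by
          rcases h2 with h2 | h2
          · exact h2
          · exact absurd (Fin.ext (by omega)) hef
        subst h2
        have hn : p i ≠ i := fun h => hef (Fin.ext (by omega))
        refine ⟨?_, fun j hj => le_of_mem_blk hp hj, one_lt_card_blk.2 (hf.resolve_right hn)⟩
        intro h
        exact hef (le_antisymm l1 (h e (self_mem_blk e)))

lemma toNCL_aux {n : ℕ} {p q : ℕ → ℕ} (hp : Good n p) (hq : Good n q)
    (h : toNCL n p = toNCL n q) (j : Fin n) (hj : p j ≠ j) : q j = p j := by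
  have hlt : p j < n := lt_of_le_of_lt (hp.1 j) j.2
  have h1 : blk n p ⟨p j, hlt⟩ ∈ toNCL n q := by
    rw [← h]; exact mem_toNCL.2 ⟨⟨p j, hlt⟩, Or.inl (used_parent hj), rfl⟩
  obtain ⟨i, -, hi⟩ := mem_toNCL.1 h1
  have h2 : j ∈ blk n q i := by rw [hi]; exact mem_blk.2 (Or.inr rfl)
  have h3 := blk_inj hq hp hi
  subst h3
  rcases mem_blk.1 h2 with h4 | h4
  · exact absurd (congrArg Fin.val h4).symm hj
  · exact h4

lemma toNCL_inj {n : ℕ} {p q : ℕ → ℕ} (hp : Good n p) (hq : Good n q)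
    (h : toNCL n p = toNCL n q) : p = q := by
  funext j
  by_cases hj : j < n
  · by_cases h1 : p j = j
    · by_cases h2 : q j = j
      · rw [h1, h2]
      · exact toNCL_aux hq hp h.symm ⟨j, hj⟩ h2
    · exact (toNCL_aux hp hq h ⟨j, hj⟩ h1).symm
  · rw [hp.2.1 j (by omega), hq.2.1 j (by omega)]

lemma toNCL_surj {n : ℕ} {π : Finset (Finset (Fin n))} (hπ : IsNCL n π) :
    ∃ p, Good n p ∧ toNCL n p = π := by
  classical
  obtain ⟨h1, h2, h3⟩ := hπ
  -- `R m j`: `j` is a non-minimal element of a block with minimum `m`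
  let R : Fin n → Fin n → Prop := fun m j =>
    ∃ B ∈ π, m ∈ B ∧ (∀ k ∈ B, m ≤ k) ∧ j ∈ B ∧ m < j
  have hmin : ∀ B ∈ π, ∃ m ∈ B, ∀ k ∈ B, m ≤ k := fun B hB =>
    ⟨B.min' (h1 B hB), B.min'_mem _, fun k hk => B.min'_le k hk⟩
  -- blocks with the same minimum agree
  have hsame : ∀ E ∈ π, ∀ F ∈ π, ∀ m, m ∈ E → m ∈ F → (∀ k ∈ E, m ≤ k) → (∀ k ∈ F, m ≤ k) →
      E = F := by
    intro E hE F hF m hmE hmF h4 h5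
    by_contra hne
    rcases (h3 E hE F hF hne).2 m (Finset.mem_inter.2 ⟨hmE, hmF⟩) with h | h
    · exact h.2.2 h5
    · exact h.1 h4
  have huniq : ∀ m m' j, R m j → R m' j → m = m' := by
    rintro m m' j ⟨E, hE, hmE, hE2, hjE, hlt⟩ ⟨F, hF, hmF, hF2, hjF, hlt'⟩
    by_cases hne : E = F
    · subst hne; exact le_antisymm (hE2 _ hmF) (hF2 _ hmE)
    · exfalso
      rcases (h3 E hE F hF hne).2 j (Finset.mem_inter.2 ⟨hjE, hjF⟩) with h | h
      · exact absurd (h.1 m hmE) (not_le.2 hlt)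
      · exact absurd (h.2.1 m' hmF) (not_le.2 hlt')
  let p : ℕ → ℕ := fun j =>
    if hj : ∃ m : Fin n, ∃ h : j < n, R m ⟨j, h⟩ then (Classical.choose hj : Fin n) else j
  have hpR : ∀ m j : Fin n, R m j → p j = m := by
    intro m j hR
    have hj : ∃ m : Fin n, ∃ h : (j : ℕ) < n, R m ⟨j, h⟩ := ⟨m, j.2, hR⟩
    have : p j = (Classical.choose hj : Fin n) := dif_pos hj
    rw [this]
    obtain ⟨_, h4⟩ := Classical.choose_spec hj
    exact congrArg Fin.val (huniq _ _ _ h4 hR)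
  have hpN : ∀ j : ℕ, p j = j ∨ ∃ m : Fin n, ∃ h : j < n, R m ⟨j, h⟩ ∧ p j = m := by
    intro j
    by_cases hj : ∃ m : Fin n, ∃ h : j < n, R m ⟨j, h⟩
    · right
      obtain ⟨m, h, hR⟩ := hj
      exact ⟨m, h, hR, hpR m ⟨j, h⟩ hR⟩
    · left; exact dif_neg hj
  have hRlt : ∀ m j, R m j → m < j := by
    rintro m j ⟨_, _, _, _, _, h⟩; exact h
  have hgood : Good n p := by
    refine ⟨?_, ?_, ?_⟩
    · intro j
      rcases hpN j with h | ⟨m, hj, hR, h⟩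
      · exact h.le
      · have := hRlt _ _ hR
        rw [Fin.lt_def] at this; simp at this; omega
    · intro j hj
      rcases hpN j with h | ⟨m, hj, hR, h⟩
      · exact h
      · omega
    · intro c d hcd hdc hlt
      rcases hpN c with h | ⟨m, hc, hR, h⟩
      · omega
      rcases hpN d with h' | ⟨m', hd, hR', h'⟩
      · omega
      obtain ⟨E, hE, hmE, hE2, hjE, hlt1⟩ := hR
      obtain ⟨F, hF, hmF, hF2, hjF, hlt2⟩ := hR'
      have hne : E ≠ F := by
        rintro rfl
        have := hF2 _ hmE
        rw [Fin.le_def] at this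
        omega
      refine (h3 E hE F hF hne).1 ⟨m, ⟨c, hc⟩, m', ⟨d, hd⟩, hmE, hjE, hmF, hjF, ?_, ?_, ?_⟩ <;>
        rw [Fin.lt_def] <;> simp <;> omega
  have hblk : ∀ B ∈ π, ∀ m ∈ B, (∀ k ∈ B, m ≤ k) → blk n p m = B := by
    intro B hB m hm hmin
    ext j
    rw [mem_blk]
    constructor
    · rintro (rfl | h)
      · exact hm
      · rcases hpN j with h' | ⟨m', hj, hR, h'⟩
        · have : j = m := Fin.ext (by omega)
          rw [this]; exact hm
        · have hmm : m' = m := Fin.ext (by omega)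
          subst hmm
          obtain ⟨E, hE, hmE, hE2, hjE, hlt1⟩ := hR
          rw [hsame B hB E hE m' hm hmE hmin hE2]
          exact hjE
    · intro hj
      rcases eq_or_lt_of_le (hmin j hj) with h | h
      · left; exact h.symm
      · right; exact hpR m j ⟨B, hB, hm, hmin, hj, h⟩
  refine ⟨p, hgood, ?_⟩
  ext B
  rw [mem_toNCL]
  constructor
  · rintro ⟨i, hi, rfl⟩
    rcases hi with ⟨c, hc, hci, hpc⟩ | hi
    · rcases hpN c with h | ⟨m, hc, hR, h⟩
      · omega
      · have hmi : m = i := Fin.ext (by omega)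
        subst hmi
        obtain ⟨E, hE, hmE, hE2, hjE, hlt1⟩ := hR
        rw [hblk E hE m hmE hE2]; exact hE
    · obtain ⟨B, hB, hiB⟩ := h2 i
      obtain ⟨m, hm, hmin'⟩ := hmin B hB
      rcases eq_or_lt_of_le (hmin' i hiB) with h | h
      · subst h; rw [hblk B hB m hm hmin']; exact hB
      · have := hpR m i ⟨B, hB, hm, hmin', hiB, h⟩
        rw [Fin.lt_def] at h; omega
  · intro hB
    obtain ⟨m, hm, hmin'⟩ := hmin B hB
    have hb := hblk B hB m hm hmin'
    refine ⟨m, ?_, hb⟩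
    by_contra hcon
    push Not at hcon
    obtain ⟨hu, hpm⟩ := hcon
    rcases hpN m with h | ⟨m', hj, hR, h⟩
    · exact hpm h
    · obtain ⟨E, hE, hmE, hE2, hjE, hlt1⟩ := hR
      have hne : B ≠ E := by
        rintro rfl
        exact absurd (hmin' _ hmE) (not_le.2 hlt1)
      rcases (h3 B hB E hE hne).2 m (Finset.mem_inter.2 ⟨hm, hjE⟩) with h4 | h4
      · rw [← hb, one_lt_card_blk] at h4
        exact hu h4.2.1
      · exact h4.1 hmin'

open Classical in
lemma card_cover {n : ℕ} {p : ℕ → ℕ} (hp : Good n p) (i : Fin n) :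
    ((toNCL n p).filter fun B => i ∈ B).card = if Used n p i ∧ p i ≠ i then 2 else 1 := by
  have hlt : p i < n := lt_of_le_of_lt (hp.1 i) i.2
  have hmem : ∀ B, B ∈ (toNCL n p).filter (fun B => i ∈ B) ↔
      B = blk n p ⟨p i, hlt⟩ ∨ (Used n p i ∧ B = blk n p i) := by
    intro B
    rw [Finset.mem_filter, mem_toNCL]
    constructor
    · rintro ⟨⟨j, hj, rfl⟩, hi⟩
      rcases mem_blk.1 hi with rfl | h
      · rcases hj with hj | hj
        · exact Or.inr ⟨hj, rfl⟩
        · left; congr 1; exact Fin.ext hj.symm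
      · left; congr 1; exact Fin.ext h.symm
    · rintro (rfl | ⟨hu, rfl⟩)
      · refine ⟨⟨⟨p i, hlt⟩, ?_, rfl⟩, mem_blk.2 (Or.inr rfl)⟩
        by_cases h : p i = i
        · right; simp [h]
        · left; exact used_parent h
      · exact ⟨⟨i, Or.inl hu, rfl⟩, self_mem_blk i⟩
  split_ifs with h
  · have : (toNCL n p).filter (fun B => i ∈ B) = {blk n p ⟨p i, hlt⟩, blk n p i} := by
      ext B; rw [hmem]; simp [h.1]
    rw [this, Finset.card_pair]
    intro h'
    exact h.2 (congrArg Fin.val (blk_inj hp hp h'))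
  · have : (toNCL n p).filter (fun B => i ∈ B) = {blk n p ⟨p i, hlt⟩} := by
      ext B; rw [hmem, Finset.mem_singleton]
      constructor
      · rintro (h' | ⟨hu, rfl⟩)
        · exact h'
        · have : p i = i := by by_contra h'; exact h ⟨hu, h'⟩
          congr 1; exact Fin.ext this.symm
      · exact Or.inl
    rw [this, Finset.card_singleton]

open Classical in
lemma dc_toNCL {n : ℕ} {p : ℕ → ℕ} (hp : Good n p) :
    dc (toNCL n p) = (Finset.univ.filter fun i : Fin n => Used n p i ∧ p i ≠ i).card := by
  unfold dc
  congr 1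
  ext i
  have := card_cover hp i
  simp only [Finset.mem_filter, Finset.mem_univ, true_and]
  by_cases h : Used n p i ∧ p i ≠ i
  · rw [if_pos h] at this
    exact ⟨fun _ => h, fun _ => by convert this⟩
  · rw [if_neg h] at this
    refine ⟨fun h' => ?_, fun h' => absurd h' h⟩
    have h2 : (1 : ℕ) = 2 := by rw [← this]; convert h'
    omega

open Classical in
lemma sc_toNCL {n : ℕ} {p : ℕ → ℕ} (hp : Good n p) :
    sc (toNCL n p) = (Finset.univ.filter fun i : Fin n => Used n p i ∧ p i = i).card := by
  unfold sc
  congr 1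
  ext i
  have := card_cover hp i
  simp only [Finset.mem_filter, Finset.mem_univ, true_and]
  constructor
  · rintro ⟨h1, B, hB, hi, hmin, hc⟩
    obtain ⟨j, hj, rfl⟩ := mem_toNCL.1 hB
    have hij : i = j := le_antisymm (hmin j (self_mem_blk j)) (le_of_mem_blk hp hi)
    subst hij
    have hu : Used n p i := one_lt_card_blk.1 hc
    refine ⟨hu, ?_⟩
    by_contra hne
    rw [if_pos ⟨hu, hne⟩] at this
    have h2 : (2 : ℕ) = 1 := by rw [← this]; convert h1
    omega
  · rintro ⟨hu, h⟩
    rw [if_neg (fun h' => h'.2 h)] at this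
    exact ⟨by convert this, blk n p i, mem_toNCL.2 ⟨i, Or.inl hu, rfl⟩, self_mem_blk i,
      fun j hj => le_of_mem_blk hp hj, one_lt_card_blk.2 hu⟩

open Classical in
lemma sg_toNCL {n : ℕ} {p : ℕ → ℕ} (hp : Good n p) :
    sg (toNCL n p) = (Finset.univ.filter fun i : Fin n => ¬ Used n p i ∧ p i = i).card := by
  unfold sg
  rw [← Finset.card_image_of_injective (f := blk n p) _ (fun i j h => blk_inj hp hp h)]
  congr 1
  ext B
  simp only [Finset.mem_filter, Finset.mem_image, mem_toNCL, Finset.mem_univ, true_and]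
  constructor
  · rintro ⟨⟨i, hi, rfl⟩, hc⟩
    have hu : ¬ Used n p i := fun h => by
      have := one_lt_card_blk.2 h; omega
    exact ⟨i, ⟨hu, hi.resolve_left hu⟩, rfl⟩
  · rintro ⟨i, ⟨hu, hi⟩, rfl⟩
    refine ⟨⟨i, Or.inr hi, rfl⟩, ?_⟩
    have h1 := mt one_lt_card_blk.1 hu
    have h2 := Finset.card_pos.2 ⟨i, self_mem_blk (p := p) i⟩
    omega

lemma W0_eq (α β γ : ℂ) {n : ℕ} {p : ℕ → ℕ} (hp : Good n p) :
    W0 α β γ n p = α ^ dc (toNCL n p) * β ^ sc (toNCL n p) * γ ^ sg (toNCL n p) := by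
  classical
  rw [dc_toNCL hp, sc_toNCL hp, sg_toNCL hp, W0, Finset.prod_range]
  simp only [← Finset.prod_const, Finset.prod_filter]
  rw [← Finset.prod_mul_distrib, ← Finset.prod_mul_distrib]
  refine Finset.prod_congr rfl fun i _ => ?_
  by_cases hu : Used n p i <;> by_cases h : p i = i <;> simp [cA, cB, hu, h]

lemma sum_W0 (α β γ : ℂ) (n : ℕ) : ∑ p ∈ S n, W0 α β γ n p =
    ∑ π ∈ NCL n, α ^ dc π * β ^ sc π * γ ^ sg π := by
  refine Finset.sum_bij (fun p _ => toNCL n p) ?_ ?_ ?_ ?_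
  · intro p hp
    rw [mem_S] at hp
    simpa [NCL] using isNCL_toNCL hp
  · intro p hp q hq h
    rw [mem_S] at hp hq
    exact toNCL_inj hp hq h
  · intro π hπ
    have hπ' : IsNCL n π := by simpa [NCL] using hπ
    obtain ⟨p, hp, h⟩ := toNCL_surj hπ'
    exact ⟨p, (mem_S n p).2 hp, h⟩
  · intro p hp
    rw [mem_S] at hp
    exact W0_eq α β γ hp

end NCLAux

/-- The vacuum moments of `X = γ·1 + β·ℓ + ℓ* + (1+α)·ℓℓ* + α·ℓ²ℓ*`, where `ℓ` is the
unilateral shift (left creation operator) with respect to an orthonormal sequence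
`(eₙ)` and `ℓ*` is its adjoint, are the generating polynomials of the statistics
`(dc, sc, sg)` over non-crossing linked partitions. -/
theorem vacuum_moments_ncl {H : Type*} [NormedAddCommGroup H] [InnerProductSpace ℂ H]
    (e : ℕ → H) (he : Orthonormal ℂ e)
    (l lstar : Module.End ℂ H)
    (hl : ∀ k : ℕ, l (e k) = e (k + 1))
    (hls0 : lstar (e 0) = 0)
    (hls : ∀ k : ℕ, lstar (e (k + 1)) = e k)
    (hadj : ∀ x y : H, ⟪l x, y⟫_ℂ = ⟪x, lstar y⟫_ℂ)
    (α β γ : ℝ) (X : Module.End ℂ H)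
    (hX : X = (γ : ℂ) • (1 : Module.End ℂ H) + (β : ℂ) • l + lstar
        + ((1 + α : ℝ) : ℂ) • (l * lstar) + (α : ℂ) • (l * l * lstar)) :
    ∀ n : ℕ, ⟪(X ^ n) (e 0), e 0⟫_ℂ
      = ∑ π ∈ NCL n, (α : ℂ) ^ dc π * (β : ℂ) ^ sc π * (γ : ℂ) ^ sg π := by
  intro n
  have hX' : X = (γ : ℂ) • (1 : Module.End ℂ H) + (β : ℂ) • l + lstar
        + (1 + (α : ℂ)) • (l * lstar) + (α : ℂ) • (l * l * lstar) := by
    rw [hX]; push_cast; rfl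
  rw [hX', NCLAux.phi_pow e l lstar hl hls0 hls, NCLAux.inner_phi e he, NCLAux.P,
    Polynomial.finsetSum_coeff]
  simp only [NCLAux.W_coeff]
  rw [NCLAux.sum_W0]
  simp
end
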